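/- arXiv:1501.02418 — 3 statements merged into one kernel-verified Lean document; each statement's English description precedes it below -/
import Mathlib

section
/- If G = A * B is a free product of finitely presentable groups A and B, then T(G) = T(A) + T(B). -/
/-- The set of values `Σ_i max(0, |r_i| - 2)` attained by finite presentations of `G`. -/
def presLengthValues (G : Type*) [Group G] : Set ℕ :=
  { t | ∃ (n : ℕ) (rels : List (FreeGroup (Fin n))),
      Nonempty (G ≃* PresentedGroup {r | r ∈ rels}) ∧
      t = (rels.map (fun r => FreeGroup.norm r - 2)).sum }

/-- A group is finitely presentable if it admits a finite presentation. -/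
def FinitelyPresentable (G : Type*) [Group G] : Prop :=
  (presLengthValues G).Nonempty

/-- The presentation length (Delzant's T-invariant) of a group. -/
noncomputable def presLength (G : Type*) [Group G] : ℕ :=
  sInf (presLengthValues G)

/-- The stable presentation length of a group. -/
noncomputable def stablePresLength (G : Type*) [Group G] : ℝ :=
  sInf { x : ℝ | ∃ H : Subgroup G, H.index ≠ 0 ∧
      x = (presLength H : ℝ) / (H.index : ℝ) }

namespace PresLength

open Monoid

section Presentations

/-- The contribution `max(0, |r| - 2)` of a relator to the length of a presentation. -/
def cost {E : Type*} [DecidableEq E] (r : FreeGroup E) : ℕ := r.norm - 2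

theorem norm_lift_le {E E' : Type*} [DecidableEq E] [DecidableEq E'] (f : E → FreeGroup E')
    (hf : ∀ e, (f e).norm ≤ 1) (r : FreeGroup E) : (FreeGroup.lift f r).norm ≤ r.norm := by
  have key : ∀ L : List (E × Bool), (FreeGroup.lift f (FreeGroup.mk L)).norm ≤ L.length := by
    intro L
    induction L with
    | nil => simp
    | cons x L ih =>
      rw [FreeGroup.lift_mk] at ih ⊢
      rw [List.map_cons, List.prod_cons, List.length_cons]
      refine (FreeGroup.norm_mul_le _ _).trans ?_
      have : (cond x.2 (f x.1) (f x.1)⁻¹).norm ≤ 1 := by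
        cases x.2 <;> simpa using hf x.1
      lia
  simpa [FreeGroup.mk_toWord, FreeGroup.norm] using key r.toWord

theorem exists_mem_presLengthValues_le {E G : Type*} [Fintype E] [DecidableEq E] [Group G] (f : FreeGroup E →* G)
    (hf : Function.Surjective f) (R : List (FreeGroup E))
    (hk : f.ker = Subgroup.normalClosure {r | r ∈ R}) :
    ∃ t ∈ presLengthValues G, t ≤ (R.map cost).sum := by
  let e := Fintype.equivFin E
  let c := FreeGroup.freeGroupCongr e
  have hsurj : Function.Surjective (f.comp c.symm.toMonoidHom) := hf.comp c.symm.surjective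
  have hker : (f.comp c.symm.toMonoidHom).ker = Subgroup.normalClosure {r | r ∈ R.map c} := by
    have h1 : {r | r ∈ R.map c} = c.toMonoidHom '' {r | r ∈ R} := by
      ext r; simp
    rw [h1, ← Subgroup.map_normalClosure _ c.toMonoidHom c.surjective, ← hk]
    ext h
    simp only [MonoidHom.mem_ker, Subgroup.mem_map]
    constructor
    · intro hh
      exact ⟨c.symm h, hh, c.apply_symm_apply h⟩
    · rintro ⟨x, hx, rfl⟩
      simpa using hx
  have hmem : ((R.map c).map (fun r => FreeGroup.norm r - 2)).sum ∈ presLengthValues G :=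
    ⟨Fintype.card E, R.map c,
      ⟨(QuotientGroup.quotientKerEquivOfSurjective _ hsurj).symm.trans
        (QuotientGroup.quotientMulEquivOfEq hker)⟩, rfl⟩
  refine ⟨_, hmem, ?_⟩
  rw [List.map_map]
  refine List.sum_le_sum fun r _ => Nat.sub_le_sub_right ?_ 2
  have h2 : c r = FreeGroup.lift (fun x => FreeGroup.of (e x)) r := by
    change FreeGroup.map e r = _
    rw [FreeGroup.map_eq_lift]; rfl
  simp only [h2]
  exact norm_lift_le _ (fun x => by simp) r

theorem presLength_le {E G : Type*} [Fintype E] [DecidableEq E] [Group G] (f : FreeGroup E →* G)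
    (hf : Function.Surjective f) (R : List (FreeGroup E))
    (hk : f.ker = Subgroup.normalClosure {r | r ∈ R}) :
    presLength G ≤ (R.map cost).sum := by
  obtain ⟨t, ht, hle⟩ := exists_mem_presLengthValues_le f hf R hk
  exact (Nat.sInf_le ht).trans hle

theorem exists_presentation {G : Type*} [Group G] (hG : FinitelyPresentable G) :
    ∃ (n : ℕ) (f : FreeGroup (Fin n) →* G) (R : List (FreeGroup (Fin n))),
      Function.Surjective f ∧ f.ker = Subgroup.normalClosure {r | r ∈ R} ∧
      (R.map cost).sum = presLength G := by
  obtain ⟨n, R, ⟨φ⟩, h⟩ := Nat.sInf_mem hG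
  refine ⟨n, φ.symm.toMonoidHom.comp (PresentedGroup.mk _), R,
    φ.symm.surjective.comp (PresentedGroup.mk_surjective _), ?_, h.symm⟩
  ext x
  simp only [MonoidHom.mem_ker, MonoidHom.comp_apply]
  rw [← PresentedGroup.mk_eq_one_iff]
  exact φ.symm.map_eq_one_iff

theorem presLengthValues_congr {G H : Type*} [Group G] [Group H] (e : G ≃* H) :
    presLengthValues G = presLengthValues H := by
  ext t
  constructor
  · rintro ⟨n, R, ⟨φ⟩, h⟩
    exact ⟨n, R, ⟨e.symm.trans φ⟩, h⟩
  · rintro ⟨n, R, ⟨φ⟩, h⟩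
    exact ⟨n, R, ⟨e.trans φ⟩, h⟩

theorem presLength_congr {G H : Type*} [Group G] [Group H] (e : G ≃* H) :
    presLength G = presLength H := by
  rw [presLength, presLength, presLengthValues_congr e]

/-- The union of presentations of `A` and `B` presents `A * B`. -/
theorem exists_mem_presLengthValues_coprod_le {A B : Type*} [Group A] [Group B]
    (hA : FinitelyPresentable A) (hB : FinitelyPresentable B) :
    ∃ t ∈ presLengthValues (Coprod A B), t ≤ presLength A + presLength B := by
  obtain ⟨n, f, R, hf, hfk, hR⟩ := exists_presentation hA
  obtain ⟨m, g, S, hg, hgk, hS⟩ := exists_presentation hB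
  let i : FreeGroup (Fin n) →* FreeGroup (Fin n ⊕ Fin m) :=
    FreeGroup.lift fun x => FreeGroup.of (Sum.inl x)
  let j : FreeGroup (Fin m) →* FreeGroup (Fin n ⊕ Fin m) :=
    FreeGroup.lift fun x => FreeGroup.of (Sum.inr x)
  let T : List (FreeGroup (Fin n ⊕ Fin m)) := R.map i ++ S.map j
  let F : FreeGroup (Fin n ⊕ Fin m) →* Coprod A B :=
    FreeGroup.lift (Sum.elim (fun x => Coprod.inl (f (.of x))) fun x => Coprod.inr (g (.of x)))
  have hFi : F.comp i = Coprod.inl.comp f := by ext x; simp [F, i]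
  have hFj : F.comp j = Coprod.inr.comp g := by ext x; simp [F, j]
  have hF : Function.Surjective F := by
    rw [← MonoidHom.range_eq_top, eq_top_iff, ← Coprod.range_inl_sup_range_inr, sup_le_iff]
    constructor
    · rintro _ ⟨a, rfl⟩
      obtain ⟨x, rfl⟩ := hf a
      exact ⟨i x, DFunLike.congr_fun hFi x⟩
    · rintro _ ⟨a, rfl⟩
      obtain ⟨x, rfl⟩ := hg a
      exact ⟨j x, DFunLike.congr_fun hFj x⟩
  have hker : F.ker = Subgroup.normalClosure {r | r ∈ T} := by
    apply le_antisymm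
    · let q := PresentedGroup.mk {r | r ∈ T}
      have hi : f.ker ≤ (q.comp i).ker := by
        rw [hfk]
        refine Subgroup.normalClosure_le_normal fun r hr => ?_
        refine PresentedGroup.one_of_mem (x := i r) ?_
        exact List.mem_append_left _ (List.mem_map_of_mem hr)
      have hj : g.ker ≤ (q.comp j).ker := by
        rw [hgk]
        refine Subgroup.normalClosure_le_normal fun r hr => ?_
        refine PresentedGroup.one_of_mem (x := j r) ?_
        exact List.mem_append_right _ (List.mem_map_of_mem hr)
      let φ := (f.liftOfSurjective hf) ⟨q.comp i, hi⟩
      let ψ := (g.liftOfSurjective hg) ⟨q.comp j, hj⟩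
      have hq : (Coprod.lift φ ψ).comp F = q := by
        ext x
        rcases x with x | x
        · simp only [F, MonoidHom.comp_apply, FreeGroup.lift_apply_of, Sum.elim_inl,
            Coprod.lift_apply_inl, φ]
          rw [MonoidHom.liftOfRightInverse_comp_apply]
          simp [i]
        · simp only [F, MonoidHom.comp_apply, FreeGroup.lift_apply_of, Sum.elim_inr,
            Coprod.lift_apply_inr, ψ]
          rw [MonoidHom.liftOfRightInverse_comp_apply]
          simp [j]
      intro h hh
      rw [← PresentedGroup.mk_eq_one_iff]
      change q h = 1
      rw [← hq, MonoidHom.comp_apply, hh, map_one]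
    · refine Subgroup.normalClosure_le_normal fun r hr => ?_
      rcases List.mem_append.1 hr with hr | hr
      · obtain ⟨s, hs, rfl⟩ := List.mem_map.1 hr
        have : f s = 1 := by
          rw [← MonoidHom.mem_ker, hfk]; exact Subgroup.subset_normalClosure hs
        simpa [this] using DFunLike.congr_fun hFi s
      · obtain ⟨s, hs, rfl⟩ := List.mem_map.1 hr
        have : g s = 1 := by
          rw [← MonoidHom.mem_ker, hgk]; exact Subgroup.subset_normalClosure hs
        simpa [this] using DFunLike.congr_fun hFj s
  obtain ⟨t, ht, hle⟩ := exists_mem_presLengthValues_le F hF T hker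
  refine ⟨t, ht, hle.trans ?_⟩
  rw [← hR, ← hS, List.map_append, List.sum_append, List.map_map, List.map_map]
  refine add_le_add ?_ ?_ <;>
  exact List.sum_le_sum fun r _ => Nat.sub_le_sub_right (norm_lift_le _ (fun x => by simp) r) 2

end Presentations

section Connections

/-- `Conn src tgt P v h w`: the word `h` can be read along a path from `v` to `w` in the graph with
edges `E`, using only edges satisfying `P`. -/
inductive Conn {E V : Type*} (src tgt : E → V) (P : E → Prop) : V → FreeGroup E → V → Prop
  | one (v : V) : Conn src tgt P v 1 v
  | of (e : E) : P e → Conn src tgt P (src e) (FreeGroup.of e) (tgt e)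
  | inv {v w : V} {h : FreeGroup E} : Conn src tgt P v h w → Conn src tgt P w h⁻¹ v
  | mul {u v w : V} {h k : FreeGroup E} :
      Conn src tgt P u h v → Conn src tgt P v k w → Conn src tgt P u (h * k) w

theorem Conn.map {E E' V V' : Type*} {src tgt : E → V} {P : E → Prop} {src' tgt' : E' → V'}
    {P' : E' → Prop} (f : V → V') (φ : FreeGroup E →* FreeGroup E')
    (H : ∀ e, P e → Conn src' tgt' P' (f (src e)) (φ (.of e)) (f (tgt e))) {v w : V}
    {h : FreeGroup E} (hc : Conn src tgt P v h w) : Conn src' tgt' P' (f v) (φ h) (f w) := by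
  induction hc with
  | one v => simpa using Conn.one (f v)
  | of e he => exact H e he
  | inv _ ih => simpa using ih.inv
  | mul _ _ ih1 ih2 => simpa using ih1.mul ih2

theorem Conn.mono {E V : Type*} {src tgt : E → V} {P P' : E → Prop} (H : ∀ e, P e → P' e)
    {v w : V} {h : FreeGroup E} (hc : Conn src tgt P v h w) : Conn src tgt P' v h w :=
  hc.map id (MonoidHom.id _) fun e he => Conn.of e (H e he)

/-- Two homomorphisms which differ by a gauge transformation on edges do so on all paths. -/
theorem Conn.gauge {E V H : Type*} [Group H] {src tgt : E → V} {P : E → Prop}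
    (φ ψ : FreeGroup E →* H) (γ : V → H)
    (hγ : ∀ e, P e → φ (.of e) = (γ (src e))⁻¹ * ψ (.of e) * γ (tgt e)) {v w : V}
    {h : FreeGroup E} (hc : Conn src tgt P v h w) : φ h = (γ v)⁻¹ * ψ h * γ w := by
  induction hc with
  | one v => simp
  | of e he => exact hγ e he
  | inv _ ih => simp [ih, mul_assoc]
  | mul _ _ ih1 ih2 => simp [ih1, ih2, mul_assoc]

theorem Conn.map_mem {E V H : Type*} [Group H] {src tgt : E → V} {P : E → Prop}
    (φ : FreeGroup E →* H) (S : Subgroup H) (hS : ∀ e, P e → φ (.of e) ∈ S) {v w : V}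
    {h : FreeGroup E} (hc : Conn src tgt P v h w) : φ h ∈ S := by
  induction hc with
  | one v => simp
  | of e he => exact hS e he
  | inv _ ih => simpa using ih
  | mul _ _ ih1 ih2 => simpa using S.mul_mem ih1 ih2

/-- A path leaving `w` uses an edge with exactly one endpoint `w`. -/
theorem Conn.exists_edge {E V : Type*} {src tgt : E → V} {P : E → Prop} {v w : V}
    {h : FreeGroup E} (hc : Conn src tgt P v h w) (hvw : v ≠ w) :
    ∃ e, P e ∧ ((src e ≠ w ∧ tgt e = w) ∨ (src e = w ∧ tgt e ≠ w)) := by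
  by_contra! hcon
  have key : ∀ {a b : V} {k : FreeGroup E}, Conn src tgt P a k b → (a = w ↔ b = w) := by
    intro a b k hk
    induction hk with
    | one v => rfl
    | of e he =>
      have := hcon e he
      tauto
    | inv _ ih => exact ih.symm
    | mul _ _ ih1 ih2 => exact ih1.trans ih2
  exact hvw ((key hc).2 rfl)

end Connections

section Complexes

variable {ι : Type*} (G : ι → Type*) [∀ i, Group (G i)]

/-- The factor `G i` of the free product. -/
def factor (i : ι) : Subgroup (CoprodI G) := (CoprodI.of (M := G) (i := i)).range

variable {G}

/-- A coloured two-complex with edges `E`, relators `N` and base vertex `o`, whose edges are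
labelled by elements of the factors, and whose fundamental group at `o` is identified with the free
product via these labels. -/
structure Valid {E V : Type*} (src tgt : E → V) (col : E → ι) (lab : FreeGroup E →* CoprodI G)
    (N : Set (FreeGroup E)) (o : V) : Prop where
  lab_mem : ∀ e, lab (.of e) ∈ factor G (col e)
  conn : ∀ e, ∃ h, Conn src tgt (fun _ => True) o h (src e)
  full : ∀ g, ∃ h, Conn src tgt (fun _ => True) o h o ∧ lab h = g
  faithful : ∀ h, Conn src tgt (fun _ => True) o h o → lab h = 1 → h ∈ Subgroup.normalClosure N
  sound : ∀ r ∈ N, lab r = 1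

/-- All relators are monochromatic closed paths. -/
def Mono {E V : Type*} (src tgt : E → V) (col : E → ι) (M : List (FreeGroup E)) : Prop :=
  ∀ r ∈ M, ∃ i v, Conn src tgt (fun e => col e = i) v r v

theorem Valid.faithful_at {E V : Type*} {src tgt : E → V} {col : E → ι}
    {lab : FreeGroup E →* CoprodI G} {N : Set (FreeGroup E)} {o u : V}
    (hV : Valid src tgt col lab N o) {k h : FreeGroup E}
    (hk : Conn src tgt (fun _ => True) o k u) (hh : Conn src tgt (fun _ => True) u h u)
    (h1 : lab h = 1) : h ∈ Subgroup.normalClosure N := by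
  have h2 := hV.faithful (k * h * k⁻¹) ((hk.mul hh).mul hk.inv) (by simp [h1])
  have h3 := Subgroup.normalClosure_normal.conj_mem _ h2 k⁻¹
  simpa [mul_assoc] using h3

/-- Vertices joined by a path `p` with trivial label may be identified if `p` becomes a relator. -/
theorem Valid.identify [DecidableEq V] {E : Type*} {src tgt : E → V} {col : E → ι}
    {lab : FreeGroup E →* CoprodI G} {N N' : Set (FreeGroup E)} {o a b : V} {p : FreeGroup E}
    (hV : Valid src tgt col lab N o) (hp : Conn src tgt (fun _ => True) a p b)
    (hp' : p ∈ Subgroup.normalClosure N') (hN : N ⊆ Subgroup.normalClosure N')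
    (hs : ∀ r ∈ N', lab r = 1) :
    Valid (Function.update id b a ∘ src) (Function.update id b a ∘ tgt) col lab N'
      (Function.update id b a o) := by
  have hlab : ∀ r ∈ Subgroup.normalClosure N', lab r = 1 := by
    have : Subgroup.normalClosure N' ≤ lab.ker := Subgroup.normalClosure_le_normal hs
    exact this
  set π : V → V := Function.update id b a with hπ
  let c : V → FreeGroup E := fun u => if u = b then p⁻¹ else 1
  have hc : ∀ u, Conn src tgt (fun _ => True) (π u) (c u)⁻¹ u := by
    intro u
    by_cases hu : u = b
    · subst hu; simpa [π, c] using hp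
    · simpa [π, c, hu] using Conn.one u
  have hcN : ∀ u, c u ∈ Subgroup.normalClosure N' := by
    intro u
    by_cases hu : u = b
    · simpa [c, hu] using hp'
    · simp [c, hu]
  let σ : FreeGroup E →* FreeGroup E :=
    FreeGroup.lift fun e => (c (src e))⁻¹ * .of e * c (tgt e)
  have hσ : ∀ {v w : V} {h : FreeGroup E},
      Conn (π ∘ src) (π ∘ tgt) (fun _ => True) v h w → Conn src tgt (fun _ => True) v (σ h) w := by
    intro v w h hh
    refine hh.map id σ fun e _ => ?_
    simpa [σ] using ((hc (src e)).mul (Conn.of e trivial)).mul (hc (tgt e)).inv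
  have hπc : ∀ {v w : V} {h : FreeGroup E}, Conn src tgt (fun _ => True) v h w →
      Conn (π ∘ src) (π ∘ tgt) (fun _ => True) (π v) h (π w) := by
    intro v w h hh
    exact hh.map π (MonoidHom.id _) fun e _ => Conn.of (src := π ∘ src) (tgt := π ∘ tgt) e trivial
  have hmk : (PresentedGroup.mk N').comp σ = PresentedGroup.mk N' := by
    ext e
    have h1 : ∀ u, PresentedGroup.mk N' (c u) = 1 := fun u =>
      PresentedGroup.mk_eq_one_iff.2 (hcN u)
    simp [σ, h1]
  have hlabσ : lab.comp σ = lab := by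
    ext e
    simp [σ, hlab _ (hcN _)]
  refine ⟨hV.lab_mem, fun e => ?_, fun g => ?_, fun h hh h1 => ?_, hs⟩
  · obtain ⟨h, hh⟩ := hV.conn e
    exact ⟨h, hπc hh⟩
  · obtain ⟨h, hh, h1⟩ := hV.full g
    exact ⟨h, hπc hh, h1⟩
  · have hconn : ∃ k, Conn src tgt (fun _ => True) o k (π o) := by
      by_cases hob : o = b
      · subst hob; exact ⟨p⁻¹, by simpa [π] using hp.inv⟩
      · exact ⟨1, by simpa [π, hob] using Conn.one o⟩
    obtain ⟨k, hk⟩ := hconn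
    have h2 := hV.faithful_at hk (hσ hh) (by simpa [h1] using DFunLike.congr_fun hlabσ h)
    have h3 : σ h ∈ Subgroup.normalClosure N' := Subgroup.normalClosure_le_normal hN h2
    rw [← PresentedGroup.mk_eq_one_iff, ← hmk]
    exact PresentedGroup.mk_eq_one_iff.2 h3

/-- A path with trivial label in one colour joining distinct vertices allows to contract an edge,
without increasing the lengths of the relators. -/
theorem Valid.contract {E V : Type*} [Fintype E] [DecidableEq E] {src tgt : E → V} {col : E → ι}
    {lab : FreeGroup E →* CoprodI G} {M : List (FreeGroup E)} {o v w : V} {p : FreeGroup E} {i : ι}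
    (hV : Valid src tgt col lab {r | r ∈ M} o) (hM : Mono src tgt col M) (hvw : v ≠ w)
    (hp : Conn src tgt (fun e => col e = i) v p w) (hlp : lab p = 1) :
    ∃ (e₀ : E) (src' tgt' : {e // e ≠ e₀} → V) (lab' : FreeGroup {e // e ≠ e₀} →* CoprodI G)
      (M' : List (FreeGroup {e // e ≠ e₀})) (o' : V),
      Valid src' tgt' (fun e => col e) lab' {r | r ∈ M'} o' ∧ Mono src' tgt' (fun e => col e) M' ∧
      (M'.map cost).sum ≤ (M.map cost).sum := by
  classical
  obtain ⟨e₀, he₀, x, hxw, ê, hêc, hê⟩ : ∃ e₀, col e₀ = i ∧ ∃ x, x ≠ w ∧ ∃ ê,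
      Conn src tgt (fun e => e = e₀) x ê w ∧
        ((src e₀ = x ∧ tgt e₀ = w ∧ ê = .of e₀) ∨
          (src e₀ = w ∧ tgt e₀ = x ∧ ê = (.of e₀)⁻¹)) := by
    obtain ⟨e, he, ⟨h1, h2⟩ | ⟨h1, h2⟩⟩ := hp.exists_edge hvw
    · exact ⟨e, he, src e, h1, .of e, h2 ▸ Conn.of (P := (· = e)) e rfl, .inl ⟨rfl, h2, rfl⟩⟩
    · exact ⟨e, he, tgt e, h2, (.of e)⁻¹, h1 ▸ (Conn.of (P := (· = e)) e rfl).inv,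
        .inr ⟨h1, rfl, rfl⟩⟩
  let κ : FreeGroup E →* FreeGroup {e // e ≠ e₀} :=
    FreeGroup.lift fun g => if h : g = e₀ then 1 else .of ⟨g, h⟩
  have hκ₀ : κ (.of e₀) = 1 := by simp [κ]
  have hκ : ∀ g : {e // e ≠ e₀}, κ (.of g) = .of g := fun g => by simp [κ, g.2]
  have hκê : κ ê = 1 := by rcases hê with ⟨-, -, rfl⟩ | ⟨-, -, rfl⟩ <;> simp [hκ₀]
  let q := (κ p)⁻¹
  let γ : V → FreeGroup {e // e ≠ e₀} := fun u => if u = w then q else 1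
  let δ : V → FreeGroup E := fun u => if u = w then ê⁻¹ else 1
  let δ' : V → FreeGroup E := fun u => if u = w then p⁻¹ else 1
  let πA : V → V := Function.update id w x
  let π : V → V := Function.update id w v
  let θ : FreeGroup E →* FreeGroup {e // e ≠ e₀} := FreeGroup.lift fun g =>
    if col g = i then (γ (src g))⁻¹ * κ (.of g) * γ (tgt g) else κ (.of g)
  let η : FreeGroup {e // e ≠ e₀} →* FreeGroup E := FreeGroup.lift fun g =>
    if col g = i then (δ (src g))⁻¹ * .of g.1 * δ (tgt g) else (δ' (src g))⁻¹ * .of g.1 * δ' (tgt g)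
  let src' : {e // e ≠ e₀} → V := fun g => if col g = i then πA (src g) else π (src g)
  let tgt' : {e // e ≠ e₀} → V := fun g => if col g = i then πA (tgt g) else π (tgt g)
  have hγw : γ w = q := by simp [γ]
  have hγ : ∀ u, u ≠ w → γ u = 1 := fun u hu => by simp [γ, hu]
  have hδw : δ w = ê⁻¹ := by simp [δ]
  have hδ : ∀ u, u ≠ w → δ u = 1 := fun u hu => by simp [δ, hu]
  have hπAw : πA w = x := by simp [πA]
  have hπA : ∀ u, u ≠ w → πA u = u := fun u hu => by simp [πA, hu]
  have hπw : π w = v := by simp [π]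
  have hπ : ∀ u, u ≠ w → π u = u := fun u hu => by simp [π, hu]
  have hθA : ∀ g, col g = i → θ (.of g) = (γ (src g))⁻¹ * κ (.of g) * γ (tgt g) :=
    fun g hg => by simp [θ, hg]
  have hθB : ∀ g, col g ≠ i → θ (.of g) = κ (.of g) := fun g hg => by simp [θ, hg]
  have hηA : ∀ g : {e // e ≠ e₀}, col g = i →
      η (.of g) = (δ (src g))⁻¹ * .of g.1 * δ (tgt g) := fun g hg => by simp [η, hg]
  have hηB : ∀ g : {e // e ≠ e₀}, col g ≠ i →
      η (.of g) = (δ' (src g))⁻¹ * .of g.1 * δ' (tgt g) := fun g hg => by simp [η, hg]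
  -- contraction of the edge, as a map of graphs in each of the colours
  have hκA : ∀ {a b : V} {h : FreeGroup E}, Conn src tgt (fun e => col e = i) a h b →
      Conn src' tgt' (fun e => col e = i) (πA a) (κ h) (πA b) := by
    intro a b h hh
    refine hh.map πA κ fun g hg => ?_
    by_cases hg0 : g = e₀
    · subst hg0
      have : πA (src g) = πA (tgt g) := by
        rcases hê with ⟨h1, h2, -⟩ | ⟨h1, h2, -⟩ <;> rw [h1, h2, hπAw, hπA x hxw]
      rw [this, hκ₀]
      exact Conn.one _
    · have := Conn.of (src := src') (tgt := tgt') (P := fun e => col e = i) ⟨g, hg0⟩ hg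
      rw [hκ ⟨g, hg0⟩]
      simpa [src', tgt', hg] using this
  have hκB : ∀ {a b : V} {h : FreeGroup E} {j : ι}, j ≠ i →
      Conn src tgt (fun e => col e = j) a h b →
      Conn src' tgt' (fun e => col e = j) (π a) (κ h) (π b) := by
    intro a b h j hj hh
    refine hh.map π κ fun g hg => ?_
    have hg0 : g ≠ e₀ := by rintro rfl; exact hj (hg.symm.trans he₀)
    have := Conn.of (src := src') (tgt := tgt') (P := fun e => col e = j) ⟨g, hg0⟩ hg
    rw [hκ ⟨g, hg0⟩]
    simpa [src', tgt', hg, hj] using this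
  have hγc : ∀ u, Conn src' tgt' (fun _ => True) (πA u) (γ u) (π u) := by
    intro u
    by_cases hu : u = w
    · subst hu
      rw [hπAw, hπw, hγw]
      have := (hκA hp).inv.mono (P' := fun _ => True) fun _ _ => trivial
      rwa [hπAw, hπA v hvw] at this
    · rw [hπA u hu, hπ u hu, hγ u hu]; exact Conn.one u
  have hθ : ∀ {a b : V} {h : FreeGroup E}, Conn src tgt (fun _ => True) a h b →
      Conn src' tgt' (fun _ => True) (π a) (θ h) (π b) := by
    intro a b h hh
    refine hh.map π θ fun g _ => ?_
    by_cases hg : col g = i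
    · rw [hθA g hg]
      exact ((hγc _).inv.mul ((hκA (Conn.of g hg)).mono fun _ _ => trivial)).mul (hγc _)
    · rw [hθB g hg]
      exact (hκB hg (Conn.of g rfl)).mono fun _ _ => trivial
  have hδc : ∀ u, Conn src tgt (fun _ => True) (πA u) (δ u)⁻¹ u := by
    intro u
    by_cases hu : u = w
    · subst hu
      rw [hπAw, hδw, inv_inv]
      exact hêc.mono fun _ _ => trivial
    · rw [hπA u hu, hδ u hu, inv_one]; exact Conn.one u
  have hδ'c : ∀ u, Conn src tgt (fun _ => True) (π u) (δ' u)⁻¹ u := by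
    intro u
    by_cases hu : u = w
    · subst hu
      simpa [δ', hπw] using hp.mono (P' := fun _ => True) fun _ _ => trivial
    · simpa [δ', hπ u hu, hu] using Conn.one u
  have hη : ∀ {a b : V} {h : FreeGroup {e // e ≠ e₀}}, Conn src' tgt' (fun _ => True) a h b →
      Conn src tgt (fun _ => True) a (η h) b := by
    intro a b h hh
    refine hh.map id η fun g _ => ?_
    by_cases hg : col g = i
    · rw [hηA g hg]
      simpa [src', tgt', hg] using ((hδc _).mul (Conn.of g.1 trivial)).mul (hδc (tgt g)).inv
    · rw [hηB g hg]
      simpa [src', tgt', hg] using ((hδ'c _).mul (Conn.of g.1 trivial)).mul (hδ'c (tgt g)).inv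
  have hθgauge : ∀ {a b : V} {h : FreeGroup E}, Conn src tgt (fun e => col e = i) a h b →
      θ h = (γ a)⁻¹ * κ h * γ b := fun hh => hh.gauge θ κ γ hθA
  have hθê : θ ê = q := by
    rw [hθgauge (hêc.mono fun e he => by rw [he]; exact he₀), hγ x hxw, hγw, hκê]; simp
  have hθδ : ∀ u, θ (δ u) = (γ u)⁻¹ := by
    intro u
    by_cases hu : u = w
    · subst hu; rw [hδw, hγw, map_inv, hθê]
    · rw [hδ u hu, hγ u hu]; simp
  have hθp : θ p = 1 := by rw [hθgauge hp, hγ v hvw, hγw]; simp [q]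
  have hθδ' : ∀ u, θ (δ' u) = 1 := by
    intro u
    by_cases hu : u = w <;> simp [δ', hu, hθp]
  have hθη : θ.comp η = MonoidHom.id _ := by
    ext g
    rw [MonoidHom.comp_apply, MonoidHom.id_apply]
    by_cases hg : col g = i
    · rw [hηA g hg]
      simp [hθA _ hg, hθδ, hκ g, mul_assoc]
    · rw [hηB g hg]
      simp [hθB _ hg, hθδ', hκ g]
  have hηκ : ∀ g, col g = i → η (κ (.of g)) = (δ (src g))⁻¹ * .of g * δ (tgt g) := by
    intro g hg
    by_cases hg0 : g = e₀
    · subst hg0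
      rw [hκ₀, map_one]
      rcases hê with ⟨h1, h2, h3⟩ | ⟨h1, h2, h3⟩ <;>
        rw [h1, h2, hδw, hδ x hxw, h3] <;> simp
    · rw [hκ ⟨g, hg0⟩, hηA ⟨g, hg0⟩ hg]
  have hηq : η q = ê * p⁻¹ := by
    have := hp.gauge (η.comp κ) (MonoidHom.id _) δ hηκ
    simp only [MonoidHom.comp_apply, hδ v hvw, hδw] at this
    simp [q, this]
  have hlγ : ∀ u, lab (η (γ u)) = (lab (δ u))⁻¹ := by
    intro u
    by_cases hu : u = w
    · subst hu; simp [hγw, hδw, hηq, hlp]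
    · simp [hγ u hu, hδ u hu]
  have hlδ' : ∀ u, lab (δ' u) = 1 := by
    intro u
    by_cases hu : u = w <;> simp [δ', hu, hlp]
  have hlab : ∀ h, lab (η (θ h)) = lab h := by
    have : (lab.comp η).comp θ = lab := by
      ext g
      simp only [MonoidHom.comp_apply]
      by_cases hg : col g = i
      · rw [hθA g hg]
        simp [hηκ g hg, hlγ, mul_assoc]
      · have hg0 : g ≠ e₀ := by rintro rfl; exact hg he₀
        rw [hθB g hg, hκ ⟨g, hg0⟩, hηB ⟨g, hg0⟩ hg]
        simp [hlδ']
    exact DFunLike.congr_fun this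
  have hlδ : ∀ u, lab (δ u) ∈ factor G i := by
    intro u
    have h1 : lab ê ∈ factor G i :=
      hêc.map_mem lab _ fun e he => by rw [he, ← he₀]; exact hV.lab_mem e₀
    by_cases hu : u = w
    · subst hu; rw [hδw, map_inv]; exact inv_mem h1
    · rw [hδ u hu, map_one]; exact one_mem _
  have hconj : ∀ r ∈ M, ∃ c, θ r = c⁻¹ * κ r * c := by
    intro r hr
    obtain ⟨j, u, hj⟩ := hM r hr
    by_cases hji : j = i
    · subst hji; exact ⟨γ u, hθgauge hj⟩
    · refine ⟨1, ?_⟩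
      have := hj.gauge θ κ (fun _ => 1) fun e he => by
        rw [hθB e (by rw [he]; exact hji)]; simp
      simpa using this
  refine ⟨e₀, src', tgt', lab.comp η, M.map κ, π o, ⟨fun g => ?_, fun g => ?_, fun g => ?_,
    fun h hh h1 => ?_, fun r hr => ?_⟩, fun r hr => ?_, ?_⟩
  · rw [MonoidHom.comp_apply]
    by_cases hg : col g = i
    · have h1 := hV.lab_mem g
      rw [hg] at h1 ⊢
      rw [hηA g hg, map_mul, map_mul, map_inv]
      exact mul_mem (mul_mem (inv_mem (hlδ _)) h1) (hlδ _)
    · rw [hηB g hg]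
      simpa [hlδ'] using hV.lab_mem g
  · obtain ⟨h, hh⟩ := hV.conn g
    by_cases hg : col g = i
    · exact ⟨_, by simpa [src', hg] using (hθ hh).mul (hγc _).inv⟩
    · exact ⟨_, by simpa [src', hg] using hθ hh⟩
  · obtain ⟨h, hh, h1⟩ := hV.full g
    exact ⟨θ h, hθ hh, by rw [MonoidHom.comp_apply, hlab, h1]⟩
  · have hconn : ∃ k, Conn src tgt (fun _ => True) o k (π o) := by
      by_cases ho : o = w
      · subst ho; exact ⟨p⁻¹, by rw [hπw]; exact hp.inv.mono fun _ _ => trivial⟩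
      · exact ⟨1, by rw [hπ o ho]; exact Conn.one o⟩
    obtain ⟨k, hk⟩ := hconn
    have h2 := hV.faithful_at hk (hη hh) h1
    have h3 : Subgroup.normalClosure {r | r ∈ M} ≤
        (Subgroup.normalClosure {r | r ∈ M.map κ}).comap θ := by
      refine Subgroup.normalClosure_le_normal fun r hr => ?_
      obtain ⟨c, hc⟩ := hconj r hr
      have h4 : κ r ∈ Subgroup.normalClosure {r | r ∈ M.map κ} :=
        Subgroup.subset_normalClosure (List.mem_map_of_mem hr)
      have h5 := Subgroup.normalClosure_normal.conj_mem _ h4 c⁻¹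
      rw [inv_inv, ← hc] at h5
      exact h5
    have h4 := h3 h2
    rw [Subgroup.mem_comap] at h4
    rwa [← MonoidHom.comp_apply, hθη] at h4
  · obtain ⟨s, hs, rfl⟩ := List.mem_map.1 hr
    obtain ⟨c, hc⟩ := hconj s hs
    have h1 : κ s = c * θ s * c⁻¹ := by rw [hc]; group
    rw [h1]
    simp [hlab, hV.sound s hs]
  · obtain ⟨s, hs, rfl⟩ := List.mem_map.1 hr
    obtain ⟨j, u, hj⟩ := hM s hs
    by_cases hji : j = i
    · subst hji; exact ⟨j, _, hκA hj⟩
    · exact ⟨j, _, hκB hji hj⟩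
  · rw [List.map_map]
    refine List.sum_le_sum fun r _ => Nat.sub_le_sub_right (norm_lift_le _ (fun g => ?_) r) 2
    split_ifs <;> simp

end Complexes

section Paths

/-- The letters of `L` are the successive edges, with orientation, of a path from `v` to `w`. -/
def IsPath {E V : Type*} (src tgt : E → V) : V → List (E × Bool) → V → Prop
  | v, [], w => v = w
  | v, (e, true) :: L, w => v = src e ∧ IsPath src tgt (tgt e) L w
  | v, (e, false) :: L, w => v = tgt e ∧ IsPath src tgt (src e) L w

theorem isPath_append {E V : Type*} {src tgt : E → V} {L L' : List (E × Bool)} {v w : V} :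
    IsPath src tgt v (L ++ L') w ↔ ∃ u, IsPath src tgt v L u ∧ IsPath src tgt u L' w := by
  induction L generalizing v with
  | nil => simp [IsPath]
  | cons x L ih =>
    rcases x with ⟨e, _ | _⟩ <;> simp [IsPath, ih, and_assoc]

theorem IsPath.invRev {E V : Type*} {src tgt : E → V} {L : List (E × Bool)} {v w : V}
    (h : IsPath src tgt v L w) : IsPath src tgt w (FreeGroup.invRev L) v := by
  induction L generalizing v with
  | nil => exact Eq.symm h
  | cons x L ih =>
    rw [FreeGroup.invRev_cons, isPath_append]
    rcases x with ⟨e, _ | _⟩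
    · exact ⟨_, ih h.2, rfl, h.1.symm⟩
    · exact ⟨_, ih h.2, rfl, h.1.symm⟩

theorem IsPath.map {E V V' : Type*} {src tgt : E → V} (f : V → V') {L : List (E × Bool)} {v w : V}
    (h : IsPath src tgt v L w) : IsPath (f ∘ src) (f ∘ tgt) (f v) L (f w) := by
  induction L generalizing v with
  | nil => exact congrArg f h
  | cons x L ih =>
    rcases x with ⟨e, _ | _⟩
    · exact ⟨congrArg f h.1, ih h.2⟩
    · exact ⟨congrArg f h.1, ih h.2⟩

theorem IsPath.conn {E V : Type*} {src tgt : E → V} {P : E → Prop} {L : List (E × Bool)} {v w : V}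
    (h : IsPath src tgt v L w) (hP : ∀ x ∈ L, P x.1) : Conn src tgt P v (FreeGroup.mk L) w := by
  induction L generalizing v with
  | nil => obtain rfl : v = w := h; exact Conn.one v
  | cons x L ih =>
    have ih' := fun {u} (hu : IsPath src tgt u L w) => ih hu fun y hy => hP y (by simp [hy])
    have hx := hP x (by simp)
    rw [← List.singleton_append, ← FreeGroup.mul_mk]
    rcases x with ⟨e, _ | _⟩
    · obtain ⟨rfl, h2⟩ := h
      exact (Conn.of e hx).inv.mul (ih' h2)
    · obtain ⟨rfl, h2⟩ := h
      exact (Conn.of e hx).mul (ih' h2)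

theorem Conn.exists_isPath {E V : Type*} {src tgt : E → V} {P : E → Prop} {h : FreeGroup E}
    {v w : V} (hc : Conn src tgt P v h w) : ∃ L, IsPath src tgt v L w ∧ FreeGroup.mk L = h := by
  induction hc with
  | one v => exact ⟨[], rfl, rfl⟩
  | of e he => exact ⟨[(e, true)], ⟨rfl, rfl⟩, rfl⟩
  | inv _ ih =>
    obtain ⟨L, hL, rfl⟩ := ih
    exact ⟨FreeGroup.invRev L, hL.invRev, FreeGroup.inv_mk.symm⟩
  | mul _ _ ih1 ih2 =>
    obtain ⟨L, hL, rfl⟩ := ih1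
    obtain ⟨L', hL', rfl⟩ := ih2
    exact ⟨L ++ L', isPath_append.2 ⟨_, hL, hL'⟩, FreeGroup.mul_mk.symm⟩

end Paths

section Runs

variable {ι : Type*} {G : ι → Type*} [∀ i, Group (G i)]

/-- A nonempty word in elements of the factors whose value is trivial contains a nonempty
monochromatic subword whose value is trivial. -/
theorem exists_run {T : Type*} (c : T → ι) (val : T → CoprodI G)
    (hval : ∀ x, val x ∈ factor G (c x)) (L : List T) (hL : L ≠ []) (h : (L.map val).prod = 1) :
    ∃ α p β i, L = α ++ (p ++ β) ∧ p ≠ [] ∧ (∀ x ∈ p, c x = i) ∧ (p.map val).prod = 1 := by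
  classical
  by_contra! H
  have hmem : ∀ (p : List T) (i : ι), (∀ x ∈ p, c x = i) → ∃ g : G i,
      CoprodI.of g = (p.map val).prod := by
    intro p i hp
    refine (factor G i).list_prod_mem fun y hy => ?_
    obtain ⟨x, hx, rfl⟩ := List.mem_map.1 hy
    rw [← hp x hx]; exact hval x
  have step : ∀ (L' p β : List T) (i : ι), (∃ α, L = α ++ L') → L' = p ++ β → p ≠ [] →
      (∀ x ∈ p, c x = i) → ∀ w : CoprodI.Word G, w.fstIdx ≠ some i →
      w.prod = (β.map val).prod →
      ∃ w' : CoprodI.Word G, w'.fstIdx = some i ∧ w'.prod = (L'.map val).prod := by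
    rintro L' p β i ⟨α, hα⟩ rfl hp hpi w hw hwp
    obtain ⟨g, hg⟩ := hmem p i hpi
    have hg1 : g ≠ 1 := by
      rintro rfl
      exact H α p β i hα hp hpi (by rw [← hg, map_one])
    refine ⟨CoprodI.Word.cons g w hw hg1, CoprodI.Word.fstIdx_cons _ _ _ _, ?_⟩
    rw [CoprodI.Word.prod_cons, hg, hwp, List.map_append, List.prod_append]
  have key : ∀ L' : List T, (∃ α, L = α ++ L') → L' ≠ [] → ∃ p β i, L' = p ++ β ∧ p ≠ [] ∧
      (∀ x ∈ p, c x = i) ∧ ∃ w : CoprodI.Word G, w.fstIdx ≠ some i ∧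
      w.prod = (β.map val).prod := by
    intro L'
    induction L' with
    | nil => simp
    | cons x L' ih =>
      rintro ⟨α, hα⟩ -
      by_cases hL' : L' = []
      · subst hL'
        exact ⟨[x], [], c x, rfl, by simp, by simp, CoprodI.Word.empty,
          by simp [CoprodI.Word.fstIdx, CoprodI.Word.empty], by simp⟩
      · have hα' : ∃ α, L = α ++ L' := ⟨α ++ [x], by simp [hα]⟩
        obtain ⟨p, β, i, hpβ, hp, hpi, w, hw, hwp⟩ := ih hα' hL'
        by_cases hx : c x = i
        · exact ⟨x :: p, β, i, by simp [hpβ], by simp, by simpa [hx] using hpi, w, hw, hwp⟩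
        · obtain ⟨w', hw', hwp'⟩ := step L' p β i hα' hpβ hp hpi w hw hwp
          exact ⟨[x], L', c x, rfl, by simp, by simp, w',
            by rw [hw']; simpa using Ne.symm hx, hwp'⟩
  obtain ⟨p, β, i, hpβ, hp, hpi, w, hw, hwp⟩ := key L ⟨[], rfl⟩ hL
  obtain ⟨w', hw', hwp'⟩ := step L p β i ⟨[], rfl⟩ hpβ hp hpi w hw hwp
  have : w' = CoprodI.Word.empty := by
    apply CoprodI.Word.equiv.symm.injective
    change w'.prod = CoprodI.Word.prod CoprodI.Word.empty
    rw [hwp', h, CoprodI.Word.prod_empty]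
  simp [this, CoprodI.Word.fstIdx, CoprodI.Word.empty] at hw'

/-- The label of an oriented edge. -/
def letterLab {E : Type*} (lab : FreeGroup E →* CoprodI G) (x : E × Bool) : CoprodI G :=
  lab (FreeGroup.mk [x])

theorem lab_mk {E : Type*} (lab : FreeGroup E →* CoprodI G) (L : List (E × Bool)) :
    lab (FreeGroup.mk L) = (L.map (letterLab lab)).prod := by
  induction L with
  | nil => exact lab.map_one
  | cons x L ih =>
    rw [← List.singleton_append, ← FreeGroup.mul_mk, map_mul, ih]
    simp [letterLab]

theorem letterLab_eq {E : Type*} (lab : FreeGroup E →* CoprodI G) (x : E × Bool) :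
    letterLab lab x = lab (.of x.1) ∨ letterLab lab x = (lab (.of x.1))⁻¹ := by
  rcases x with ⟨e, _ | _⟩
  · right; rw [← map_inv]; rfl
  · left; rfl

theorem letterLab_mem {E : Type*} {lab : FreeGroup E →* CoprodI G} {col : E → ι}
    (h : ∀ e, lab (.of e) ∈ factor G (col e)) (x : E × Bool) :
    letterLab lab x ∈ factor G (col x.1) := by
  rcases letterLab_eq lab x with hx | hx <;> rw [hx]
  · exact h _
  · exact inv_mem (h _)

/-- A path with trivial label joining distinct vertices contains a monochromatic one, up to
removing closed subpaths. -/
theorem exists_mono_conn {E V : Type*} {src tgt : E → V} {lab : FreeGroup E →* CoprodI G}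
    {col : E → ι} (h : ∀ e, lab (.of e) ∈ factor G (col e)) {o u : V} (hou : o ≠ u)
    (L : List (E × Bool)) (hL : IsPath src tgt o L u) (h1 : lab (FreeGroup.mk L) = 1) :
    ∃ i v w p, v ≠ w ∧ Conn src tgt (fun e => col e = i) v p w ∧ lab p = 1 := by
  induction hn : L.length using Nat.strong_induction_on generalizing L with
  | _ n ih =>
    have hne : L ≠ [] := by rintro rfl; exact hou hL
    rw [lab_mk] at h1
    obtain ⟨α, p, β, i, rfl, hp, hpi, hp1⟩ :=
      exists_run (fun x => col x.1) (letterLab lab) (letterLab_mem h) L hne h1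
    obtain ⟨a, hα, hpβ⟩ := isPath_append.1 hL
    obtain ⟨b, hpath, hβ⟩ := isPath_append.1 hpβ
    by_cases hab : a = b
    · subst hab
      refine ih (α ++ β).length ?_ (α ++ β) (isPath_append.2 ⟨a, hα, hβ⟩) ?_ rfl
      · have := List.length_pos_iff.2 hp
        simp only [List.length_append] at hn ⊢
        lia
      · rw [lab_mk]
        simpa [hp1] using h1
    · exact ⟨i, a, b, FreeGroup.mk p, hab, hpath.conn hpi, by rw [lab_mk, hp1]⟩

end Runs

section Folding

variable {ι : Type*} {G : ι → Type*} [∀ i, Group (G i)]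

/-- A valid complex with monochromatic relators and a single vertex splits as a union of
presentations of the factors. -/
theorem Valid.sum_presLength_le_of_loops [Fintype ι] {E V : Type*} [Fintype E] [DecidableEq E]
    {src tgt : E → V} {col : E → ι} {lab : FreeGroup E →* CoprodI G} {M : List (FreeGroup E)}
    {o : V} (hV : Valid src tgt col lab {r | r ∈ M} o) (hM : Mono src tgt col M)
    (hloop : ∀ e, src e = o ∧ tgt e = o) : ∑ i, presLength (G i) ≤ (M.map cost).sum := by
  classical
  have hall : ∀ h, Conn src tgt (fun _ => True) o h o := by
    have hof : ∀ e, Conn src tgt (fun _ => True) o (.of e) o := fun e => by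
      simpa [(hloop e).1, (hloop e).2] using Conn.of (src := src) (tgt := tgt)
        (P := fun _ => True) e trivial
    intro h
    induction h using FreeGroup.induction_on with
    | C1 => exact Conn.one o
    | of e => exact hof e
    | inv_of e _ => exact (hof e).inv
    | mul x y hx hy => exact hx.mul hy
  let κ : ∀ i, FreeGroup E →* FreeGroup {e // col e = i} := fun i =>
    FreeGroup.lift fun e => if h : col e = i then .of ⟨e, h⟩ else 1
  let incl : ∀ i, FreeGroup {e // col e = i} →* FreeGroup E := fun i =>
    FreeGroup.lift fun e => .of e.1
  let proj : ∀ i, CoprodI G →* G i := fun i => CoprodI.lift (Pi.mulSingle i (MonoidHom.id (G i)))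
  have hproj : ∀ i (g : G i), proj i (CoprodI.of g) = g := fun i g => by simp [proj]
  have hproj' : ∀ i j (g : G j), j ≠ i → proj i (CoprodI.of g) = 1 := fun i j g hij => by
    simp [proj, Pi.mulSingle_eq_of_ne hij]
  let f : ∀ i, FreeGroup {e // col e = i} →* G i := fun i => (proj i).comp (lab.comp (incl i))
  have hf : ∀ i h, lab (incl i h) = CoprodI.of (f i h) := by
    intro i
    have : lab.comp (incl i) = CoprodI.of.comp (f i) := by
      ext e
      obtain ⟨e, rfl⟩ := e
      obtain ⟨g, hg⟩ := hV.lab_mem e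
      simp [f, incl, ← hg, hproj]
    exact DFunLike.congr_fun this
  have hκ : ∀ i h, f i (κ i h) = proj i (lab h) := by
    intro i
    have : (f i).comp (κ i) = (proj i).comp lab := by
      ext e
      obtain ⟨g, hg⟩ := hV.lab_mem e
      by_cases he : col e = i
      · simp [f, κ, he, incl]
      · simp [κ, he, ← hg, hproj' _ _ _ he]
    exact DFunLike.congr_fun this
  have hκi : ∀ i h, κ i (incl i h) = h := by
    intro i
    have : (κ i).comp (incl i) = MonoidHom.id _ := by
      ext e
      simp [κ, incl, e.2]
    exact DFunLike.congr_fun this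
  have hle : ∀ i, presLength (G i) ≤ ((M.map (κ i)).map cost).sum := by
    intro i
    refine presLength_le (f i) (fun g => ?_) _ (le_antisymm (fun h hh => ?_) ?_)
    · obtain ⟨h, -, hh⟩ := hV.full (CoprodI.of g)
      exact ⟨κ i h, by rw [hκ, hh, hproj]⟩
    · have h1 : incl i h ∈ Subgroup.normalClosure {r | r ∈ M} :=
        hV.faithful _ (hall _) (by rw [hf, (hh : f i h = 1), map_one])
      have h2 : Subgroup.normalClosure {r | r ∈ M} ≤
          (Subgroup.normalClosure {r | r ∈ M.map (κ i)}).comap (κ i) :=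
        Subgroup.normalClosure_le_normal fun r hr =>
          Subgroup.subset_normalClosure (List.mem_map_of_mem hr)
      simpa [hκi] using h2 h1
    · refine Subgroup.normalClosure_le_normal fun r hr => ?_
      obtain ⟨s, hs, rfl⟩ := List.mem_map.1 hr
      change f i (κ i s) = 1
      rw [hκ, hV.sound s hs, map_one]
  refine (Finset.sum_le_sum fun i _ => hle i).trans ?_
  clear hle hV
  induction M with
  | nil => simp
  | cons r M ih =>
    have ih' := ih fun s hs => hM s (by simp [hs])
    simp only [List.map_cons, List.sum_cons, Finset.sum_add_distrib] at ih' ⊢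
    refine add_le_add ?_ ih'
    obtain ⟨j, v, hj⟩ := hM r (by simp)
    rw [Finset.sum_eq_single j]
    · exact Nat.sub_le_sub_right (norm_lift_le _ (fun e => by split_ifs <;> simp) r) 2
    · intro i _ hij
      have : κ i r ∈ (⊥ : Subgroup (FreeGroup {e // col e = i})) :=
        hj.map_mem (κ i) ⊥ fun e he => by
          have : col e ≠ i := by rw [he]; exact hij.symm
          simp [κ, this]
      rw [Subgroup.mem_bot.1 this]
      simp [cost]
    · simp

theorem Valid.sum_presLength_le_of_mono [Fintype ι] {V : Type*} (n : ℕ) {E : Type*} [Fintype E]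
    [DecidableEq E] (hn : Fintype.card E = n) {src tgt : E → V} {col : E → ι}
    {lab : FreeGroup E →* CoprodI G} {M : List (FreeGroup E)} {o : V}
    (hV : Valid src tgt col lab {r | r ∈ M} o) (hM : Mono src tgt col M) :
    ∑ i, presLength (G i) ≤ (M.map cost).sum := by
  induction n using Nat.strong_induction_on generalizing E o with
  | _ n ih =>
    by_cases hloop : ∀ e, src e = o ∧ tgt e = o
    · exact hV.sum_presLength_le_of_loops hM hloop
    have hu : ∃ u k, o ≠ u ∧ Conn src tgt (fun _ => True) o k u := by
      push Not at hloop
      obtain ⟨e, he⟩ := hloop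
      obtain ⟨k, hk⟩ := hV.conn e
      by_cases h1 : src e = o
      · exact ⟨tgt e, _, (he h1).symm, hk.mul (Conn.of e trivial)⟩
      · exact ⟨src e, k, Ne.symm h1, hk⟩
    obtain ⟨u, k, hou, hk⟩ := hu
    obtain ⟨h, hh, hlab⟩ := hV.full (lab k)⁻¹
    obtain ⟨L, hL, hLk⟩ := (hh.mul hk).exists_isPath
    obtain ⟨i, v, w, p, hvw, hp, hp1⟩ :=
      exists_mono_conn hV.lab_mem hou L hL (by rw [hLk]; simp [hlab])
    obtain ⟨e₀, src', tgt', lab', M', o', hV', hM', hcost⟩ := hV.contract hM hvw hp hp1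
    refine (ih _ ?_ rfl hV' hM').trans hcost
    rw [← hn]
    exact Fintype.card_subtype_lt (x := e₀) (by simp)

end Folding

section Cutting

/-- The number of pairs of equal successive entries. -/
def same {ι : Type*} [DecidableEq ι] : List ι → ℕ
  | [] => 0
  | [_] => 0
  | a :: b :: l => (if a = b then 1 else 0) + same (b :: l)

variable {ι : Type*} [DecidableEq ι]

theorem same_cons_le (a : ι) (l : List ι) : same (a :: l) ≤ same l + 1 := by
  cases l with
  | nil => simp [same]
  | cons b l => rw [same]; split_ifs <;> lia

theorem le_same_cons (a : ι) (l : List ι) : same l ≤ same (a :: l) := by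
  cases l with
  | nil => simp [same]
  | cons b l => rw [same]; lia

theorem same_append_le (l l' : List ι) : same (l ++ l') ≤ same l + same l' + 1 := by
  induction l with
  | nil => simp [same]
  | cons a l ih =>
    cases l with
    | nil => simpa [same] using same_cons_le a l'
    | cons b l =>
      simp only [List.cons_append, same] at ih ⊢
      lia

theorem le_same_append (l l' : List ι) : same l + same l' ≤ same (l ++ l') := by
  induction l with
  | nil => simp [same]
  | cons a l ih =>
    cases l with
    | nil => simpa [same] using le_same_cons a l'
    | cons b l =>
      simp only [List.cons_append, same] at ih ⊢
      lia

theorem length_le_same {l : List ι} {i : ι} (h : ∀ x ∈ l, x = i) : l.length ≤ same l + 1 := by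
  obtain ⟨n, rfl⟩ : ∃ n, l = List.replicate n i := ⟨_, List.eq_replicate_of_mem h⟩
  clear h
  rw [List.length_replicate]
  induction n with
  | zero => simp
  | succ n ih =>
    cases n with
    | zero => simp
    | succ n =>
      simp only [List.replicate_succ, same, if_true] at ih ⊢
      lia

theorem same_eq_zero {l : List ι} (h : l.IsChain (· ≠ ·)) : same l = 0 := by
  induction l with
  | nil => rfl
  | cons a l ih =>
    cases l with
    | nil => rfl
    | cons b l =>
      rw [List.isChain_cons_cons] at h
      simp [same, h.1, ih h.2]

variable {G : ι → Type*} [∀ i, Group (G i)]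

/-- A disc is replaced by monochromatic discs by identifying vertices on its boundary. -/
theorem Valid.cut {E V : Type*} [DecidableEq E] {src tgt : E → V} {col : E → ι}
    {lab : FreeGroup E →* CoprodI G} (hne : ∀ e, lab (.of e) ≠ 1) {N : Set (FreeGroup E)}
    {L : List (E × Bool)} {o v : V} (hV : Valid src tgt col lab ({FreeGroup.mk L} ∪ N) o)
    (hL : IsPath src tgt v L v) :
    ∃ (f : V → V) (P : List (FreeGroup E)),
      (P.map cost).sum ≤ same (L.map fun x => col x.1) - 1 ∧
      Mono (f ∘ src) (f ∘ tgt) col P ∧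
      Valid (f ∘ src) (f ∘ tgt) col lab ({r | r ∈ P} ∪ N) (f o) := by
  classical
  induction hn : L.length using Nat.strong_induction_on generalizing L src tgt o v N with
  | _ n ih =>
  have hL1 : lab (FreeGroup.mk L) = 1 := hV.sound _ (by simp)
  by_cases hnil : L = []
  · subst hnil
    refine ⟨Function.update id o o, [], by simp, by simp [Mono],
      hV.identify (Conn.one o) (one_mem _) ?_ fun r hr => hV.sound r ?_⟩
    · rintro r (rfl | hr)
      · exact one_mem _
      · exact Subgroup.subset_normalClosure (.inr hr)
    · rcases hr with hr | hr
      · simp at hr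
      · exact .inr hr
  have h1 := hL1
  rw [lab_mk] at h1
  obtain ⟨α, p, β, i, rfl, hp, hpi, hp1⟩ :=
    exists_run (fun x => col x.1) (letterLab lab) (letterLab_mem hV.lab_mem) L hnil h1
  obtain ⟨a, hα, hpβ⟩ := isPath_append.1 hL
  obtain ⟨b, hpath, hβ⟩ := isPath_append.1 hpβ
  have hp2 : 2 ≤ p.length := by
    rcases p with _ | ⟨x, _ | ⟨y, p⟩⟩
    · exact absurd rfl hp
    · rcases letterLab_eq lab x with hx | hx <;> simp [hx, hne] at hp1
    · simp
  have hp1' : lab (FreeGroup.mk p) = 1 := by rw [lab_mk, hp1]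
  have hαβ : lab (FreeGroup.mk (α ++ β)) = 1 := by
    rw [lab_mk]
    simpa [hp1] using h1
  set N' : Set (FreeGroup E) := {FreeGroup.mk (α ++ β)} ∪ ({FreeGroup.mk p} ∪ N) with hN'
  have hpN : FreeGroup.mk p ∈ Subgroup.normalClosure N' :=
    Subgroup.subset_normalClosure (.inr (.inl rfl))
  have hV' := hV.identify (hpath.conn (P := fun _ => True) fun _ _ => trivial) hpN
    (by
      rintro r (rfl | hr)
      · have h2 : FreeGroup.mk (α ++ β) ∈ Subgroup.normalClosure N' :=
          Subgroup.subset_normalClosure (.inl rfl)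
        have h3 := Subgroup.normalClosure_normal.conj_mem _ hpN (FreeGroup.mk α)
        have h4 : FreeGroup.mk (α ++ (p ++ β)) =
            FreeGroup.mk α * FreeGroup.mk p * (FreeGroup.mk α)⁻¹ * FreeGroup.mk (α ++ β) := by
          simp only [← FreeGroup.mul_mk]; group
        rw [h4]
        exact mul_mem h3 h2
      · exact Subgroup.subset_normalClosure (.inr (.inr hr)))
    (by
      rintro r (rfl | rfl | hr)
      · exact hαβ
      · exact hp1'
      · exact hV.sound r (.inr hr))
  set π : V → V := Function.update id b a with hπ
  have hπa : π a = π b := by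
    simp [hπ, Function.update_apply]
  have hcl : IsPath (π ∘ src) (π ∘ tgt) (π v) (α ++ β) (π v) :=
    isPath_append.2 ⟨π a, hα.map π, hπa ▸ hβ.map π⟩
  obtain ⟨f, P, hcost, hM, hVP⟩ := ih (α ++ β).length
    (by simp only [List.length_append] at hn ⊢; lia) hV' hcl rfl
  refine ⟨f ∘ π, FreeGroup.mk p :: P, ?_, ?_, ?_⟩
  · have c1 : cost (FreeGroup.mk p) ≤ p.length - 2 := Nat.sub_le_sub_right FreeGroup.norm_mk_le 2
    have c2 := length_le_same (l := p.map fun x => col x.1) (i := i)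
      (List.forall_mem_map.2 hpi)
    have c3 := le_same_append (α.map fun x => col x.1) ((p ++ β).map fun x => col x.1)
    have c4 := le_same_append (p.map fun x => col x.1) (β.map fun x => col x.1)
    have c5 := same_append_le (α.map fun x => col x.1) (β.map fun x => col x.1)
    simp only [List.map_append, List.map_cons, List.sum_cons, List.length_map] at *
    lia
  · intro r hr
    rcases List.mem_cons.1 hr with rfl | hr
    · have h2 := (hpath.map π).map f
      rw [← hπa] at h2
      exact ⟨i, _, h2.conn hpi⟩
    · exact hM r hr
  · have : {r | r ∈ FreeGroup.mk p :: P} ∪ N = {r | r ∈ P} ∪ ({FreeGroup.mk p} ∪ N) := by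
      ext r
      simp only [List.mem_cons, Set.mem_union, Set.mem_ofPred_eq, Set.mem_singleton_iff]
      tauto
    rw [this]
    exact hVP

theorem Valid.sum_presLength_le [Fintype ι] {E V : Type*} [Fintype E] [DecidableEq E]
    {src tgt : E → V} {col : E → ι} {lab : FreeGroup E →* CoprodI G} (hne : ∀ e, lab (.of e) ≠ 1)
    (Ls : List (List (E × Bool))) (M : List (FreeGroup E)) {o : V}
    (hV : Valid src tgt col lab {r | r ∈ Ls.map FreeGroup.mk ++ M} o)
    (hLs : ∀ L ∈ Ls, ∃ v, IsPath src tgt v L v) (hM : Mono src tgt col M) :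
    ∑ i, presLength (G i) ≤
      (Ls.map fun L => same (L.map fun x => col x.1) - 1).sum + (M.map cost).sum := by
  induction Ls generalizing src tgt o M with
  | nil => simpa using hV.sum_presLength_le_of_mono _ rfl hM
  | cons L Ls ih =>
    obtain ⟨v, hL⟩ := hLs L (by simp)
    obtain ⟨f, P, hP, hMP, hVP⟩ :=
      Valid.cut (N := {r | r ∈ Ls.map FreeGroup.mk ++ M}) (L := L) hne
        (by convert hV using 1; ext r; simp) hL
    have h := ih (src := f ∘ src) (tgt := f ∘ tgt) (P ++ M) (o := f o)
      (by
        convert hVP using 1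
        ext r
        simp only [List.mem_append, Set.mem_union, Set.mem_ofPred_eq]
        tauto)
      (fun L' hL' => by
        obtain ⟨u, hu⟩ := hLs L' (by simp [hL'])
        exact ⟨f u, hu.map f⟩)
      (fun r hr => by
        rcases List.mem_append.1 hr with hr | hr
        · exact hMP r hr
        · obtain ⟨i, u, hu⟩ := hM r hr
          exact ⟨i, f u, hu.map f (MonoidHom.id _) fun e he =>
            Conn.of (src := f ∘ src) (tgt := f ∘ tgt) e he⟩)
    simp only [List.map_append, List.map_cons, List.sum_append, List.sum_cons] at h ⊢
    lia

end Cutting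

section InitialComplex

variable {ι : Type*} {G : ι → Type*} [∀ i, Group (G i)]

/-- Any generators of a free product are subdivided into edges labelled by elements of the factors,
and the relators are subdivided accordingly. -/
theorem sum_presLength_le_presLength_coprodI [Fintype ι]
    (hG : FinitelyPresentable (CoprodI G)) :
    ∑ i, presLength (G i) ≤ presLength (CoprodI G) := by
  classical
  obtain ⟨n, labX, R, hsurj, hker, hcost⟩ := exists_presentation hG
  rw [← hcost]
  let T : Fin n → List (Σ i, G i) := fun x => (CoprodI.Word.equiv (labX (.of x))).toList
  have hTprod : ∀ x, ((T x).map fun l => CoprodI.of l.2).prod = labX (.of x) := fun x =>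
    CoprodI.Word.equiv.symm_apply_apply (labX (.of x))
  have hT1 : ∀ x, ∀ l ∈ T x, l.2 ≠ 1 := fun x => (CoprodI.Word.equiv (labX (.of x))).ne_one
  have hTc : ∀ x, (T x).IsChain fun l l' => l.1 ≠ l'.1 := fun x =>
    (CoprodI.Word.equiv (labX (.of x))).chain_ne
  let E := Σ x : Fin n, Fin (T x).length
  let col : E → ι := fun e => ((T e.1)[e.2]).1
  let lab : FreeGroup E →* CoprodI G := FreeGroup.lift fun e => CoprodI.of ((T e.1)[e.2]).2
  let vt : Fin n → ℕ → Option (Fin n × ℕ) := fun x j =>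
    if j = 0 ∨ j = (T x).length then none else some (x, j)
  let src : E → Option (Fin n × ℕ) := fun e => vt e.1 e.2
  let tgt : E → Option (Fin n × ℕ) := fun e => vt e.1 (e.2 + 1)
  let letters : Fin n → List (E × Bool) := fun x => List.ofFn fun j => (⟨x, j⟩, true)
  let S : Fin n → ℕ → FreeGroup E := fun x j => FreeGroup.mk ((letters x).drop j)
  let β : FreeGroup (Fin n) →* FreeGroup E := FreeGroup.lift fun x => FreeGroup.mk (letters x)
  let θ : FreeGroup E →* FreeGroup (Fin n) :=
    FreeGroup.lift fun e => if (e.2 : ℕ) = 0 then .of e.1 else 1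
  let γ : Option (Fin n × ℕ) → FreeGroup E := fun u => u.elim 1 fun p => S p.1 p.2
  have hlen : ∀ x, (letters x).length = (T x).length := fun x => by simp [letters]
  have hdrop : ∀ x (j : Fin (T x).length),
      (letters x).drop j = (⟨x, j⟩, true) :: (letters x).drop (j + 1) := by
    intro x j
    rw [List.drop_eq_getElem_cons (by rw [hlen]; exact j.2)]
    simp [letters]
  have hpath : ∀ x j, j ≤ (T x).length → IsPath src tgt (vt x j) ((letters x).drop j) none := by
    intro x j hj
    induction hj using Nat.decreasingInduction with
    | self => simp [← hlen, IsPath, vt]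
    | of_succ j hj ih =>
      rw [hdrop x ⟨j, hj⟩]
      exact ⟨rfl, ih⟩
  have hpath0 : ∀ x, IsPath src tgt none (letters x) none := by
    intro x
    simpa [vt] using hpath x 0 (Nat.zero_le _)
  have hlabβ : lab.comp β = labX := by
    ext x
    rw [MonoidHom.comp_apply, FreeGroup.lift_apply_of, lab_mk, ← hTprod]
    congr 1
    apply List.ext_getElem
    · simp [letters]
    · intro j h1 h2
      simp only [List.getElem_map, letters, List.getElem_ofFn]
      simp [letterLab, lab]
  have hS : ∀ x (j : Fin (T x).length), S x j = .of ⟨x, j⟩ * S x (j + 1) := by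
    intro x j
    simp only [S]
    rw [hdrop, ← List.singleton_append, ← FreeGroup.mul_mk]
    rfl
  have hγ : ∀ x j, j ≠ 0 → γ (vt x j) = S x j := by
    intro x j hj
    by_cases h : j = (T x).length
    · subst h
      simp [vt, γ, S, ← hlen, FreeGroup.one_eq_mk]
    · simp [vt, γ, hj, h]
  have hβθ : ∀ h, Conn src tgt (fun _ => True) none h none → β (θ h) = h := by
    intro h hh
    have := hh.gauge (β.comp θ) (MonoidHom.id _) γ (fun ⟨x, j⟩ _ => by
      have h1 : γ (tgt ⟨x, j⟩) = S x (j + 1) := hγ x _ (Nat.succ_ne_zero _)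
      rw [h1, MonoidHom.id_apply, mul_assoc, ← hS x j, MonoidHom.comp_apply,
        FreeGroup.lift_apply_of]
      by_cases hj : (j : ℕ) = 0
      · have h2 : γ (src ⟨x, j⟩) = 1 := by simp [src, vt, γ, hj]
        rw [h2, if_pos hj, FreeGroup.lift_apply_of, hj]
        simp [S]
      · have h2 : γ (src ⟨x, j⟩) = S x j := hγ x _ hj
        rw [h2, if_neg hj, map_one, inv_mul_cancel])
    simpa [γ] using this
  let block : Fin n × Bool → List (E × Bool) := fun y =>
    if y.2 then letters y.1 else FreeGroup.invRev (letters y.1)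
  have hblock : ∀ y, IsPath src tgt none (block y) none := by
    rintro ⟨x, _ | _⟩
    · exact (hpath0 x).invRev
    · exact hpath0 x
  have hword : ∀ L : List (Fin n × Bool), IsPath src tgt none (L.flatMap block) none := by
    intro L
    induction L with
    | nil => rfl
    | cons y L ih => exact isPath_append.2 ⟨none, hblock y, ih⟩
  have hmk : ∀ L : List (Fin n × Bool), FreeGroup.mk (L.flatMap block) = β (FreeGroup.mk L) := by
    intro L
    induction L with
    | nil => exact β.map_one.symm
    | cons y L ih =>
      rw [List.flatMap_cons, ← FreeGroup.mul_mk, ih, ← List.singleton_append,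
        ← FreeGroup.mul_mk, map_mul]
      congr 1
      rcases y with ⟨x, _ | _⟩ <;> simp [block, β, FreeGroup.inv_mk]
  have hsame : ∀ y, same ((block y).map fun e => col e.1) = 0 := by
    have h1 : ∀ x, ((letters x).map fun e => col e.1).IsChain (· ≠ ·) := by
      intro x
      have : ((letters x).map fun e => col e.1) = (T x).map fun l => l.1 := by
        apply List.ext_getElem
        · simp [letters]
        · intro j h1 h2
          simp [letters, col]
      rw [this, List.isChain_map]
      exact hTc x
    rintro ⟨x, _ | _⟩
    · apply same_eq_zero
      have := List.isChain_reverse.2 ((h1 x).imp fun _ _ h => h.symm)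
      simpa [block, FreeGroup.invRev, List.map_reverse, Function.comp_def] using this
    · exact same_eq_zero (h1 x)
  have hsame' : ∀ L : List (Fin n × Bool),
      same ((L.flatMap block).map fun e => col e.1) ≤ L.length - 1 := by
    intro L
    induction L with
    | nil => simp [same]
    | cons y L ih =>
      rw [List.flatMap_cons, List.map_append]
      rcases L with _ | ⟨z, L⟩
      · simp [hsame]
      · have := same_append_le ((block y).map fun e => col e.1)
          (((z :: L).flatMap block).map fun e => col e.1)
        rw [hsame] at this
        simp only [List.length_cons] at ih ⊢
        lia
  let Ls := R.map fun r => r.toWord.flatMap block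
  have hLs : Ls.map FreeGroup.mk = R.map β := by
    simp [Ls, hmk, FreeGroup.mk_toWord]
  have hβconn : ∀ y, Conn src tgt (fun _ => True) none (β y) none := by
    intro y
    rw [← FreeGroup.mk_toWord (x := y), ← hmk]
    exact (hword _).conn fun _ _ => trivial
  have hV : Valid src tgt col lab {r | r ∈ Ls.map FreeGroup.mk ++ []} none := by
    rw [List.append_nil, hLs]
    refine ⟨fun e => ?_, fun e => ?_, fun g => ?_, fun h hh h1 => ?_, fun r hr => ?_⟩
    · exact ⟨_, (FreeGroup.lift_apply_of ..).symm⟩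
    · exact ⟨_, ((hpath e.1 e.2 e.2.2.le).conn fun _ _ => trivial).inv⟩
    · obtain ⟨y, rfl⟩ := hsurj g
      exact ⟨β y, hβconn y, DFunLike.congr_fun hlabβ y⟩
    · have h2 : θ h ∈ labX.ker := by
        rw [MonoidHom.mem_ker, ← hlabβ, MonoidHom.comp_apply, hβθ h hh, h1]
      rw [hker] at h2
      have h3 : Subgroup.normalClosure {r | r ∈ R} ≤
          (Subgroup.normalClosure {r | r ∈ R.map β}).comap β :=
        Subgroup.normalClosure_le_normal fun r hr =>
          Subgroup.subset_normalClosure (List.mem_map_of_mem hr)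
      have h4 := h3 h2
      rwa [Subgroup.mem_comap, hβθ h hh] at h4
    · obtain ⟨s, hs, rfl⟩ := List.mem_map.1 hr
      rw [← MonoidHom.comp_apply, hlabβ, ← MonoidHom.mem_ker, hker]
      exact Subgroup.subset_normalClosure hs
  refine (hV.sum_presLength_le (fun e => ?_) Ls [] (fun L hL => ?_) (by simp [Mono])).trans ?_
  · rw [FreeGroup.lift_apply_of, ne_eq, map_eq_one_iff _ (CoprodI.of_injective _)]
    exact hT1 _ _ (List.getElem_mem _)
  · obtain ⟨r, -, rfl⟩ := List.mem_map.1 hL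
    exact ⟨none, hword _⟩
  · simp only [Ls, List.map_map, List.map_nil, List.sum_nil, add_zero]
    refine List.sum_le_sum fun r _ => ?_
    exact Nat.sub_le_sub_right (hsame' r.toWord) 1

end InitialComplex

section BinaryProducts

universe u v

/-- The family with members `A` and `B`, in a common universe. -/
def Pair (A : Type u) (B : Type v) : Bool → Type (max u v)
  | true => ULift.{v} A
  | false => ULift.{u} B

instance (A : Type u) (B : Type v) [Group A] [Group B] : ∀ b, Group (Pair A B b)
  | true => inferInstanceAs (Group (ULift A))
  | false => inferInstanceAs (Group (ULift B))

variable (A : Type u) (B : Type v) [Group A] [Group B]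

/-- The first member of `Pair A B` is `A`. -/
def pairTrue : Pair A B true ≃* A := MulEquiv.ulift

/-- The second member of `Pair A B` is `B`. -/
def pairFalse : Pair A B false ≃* B := MulEquiv.ulift

/-- The binary free product as a free product over a family. -/
def coprodEquiv : Coprod A B ≃* CoprodI (Pair A B) :=
  MonoidHom.toMulEquiv
    (Coprod.lift (CoprodI.of.comp (pairTrue A B).symm.toMonoidHom)
      (CoprodI.of.comp (pairFalse A B).symm.toMonoidHom))
    (CoprodI.lift fun
      | true => Coprod.inl.comp (pairTrue A B).toMonoidHom
      | false => Coprod.inr.comp (pairFalse A B).toMonoidHom)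
    (by ext <;> simp)
    (by ext b x; cases b <;> simp)

theorem le_presLength_coprod (h : FinitelyPresentable (Coprod A B)) :
    presLength A + presLength B ≤ presLength (Coprod A B) := by
  have e := presLengthValues_congr (coprodEquiv A B)
  have h' : FinitelyPresentable (CoprodI (Pair A B)) := by
    rwa [FinitelyPresentable, ← e]
  have := sum_presLength_le_presLength_coprodI h'
  rwa [Fintype.sum_bool, presLength_congr (pairTrue A B), presLength_congr (pairFalse A B),
    ← presLength_congr (coprodEquiv A B)] at this

end BinaryProducts

end PresLength

/-- Presentation length is additive under free products. -/
theorem presLength_freeProduct (A B : Type*) [Group A] [Group B]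
    (hA : FinitelyPresentable A) (hB : FinitelyPresentable B) :
    presLength (Monoid.Coprod A B) = presLength A + presLength B := by
  obtain ⟨t, ht, hle⟩ := PresLength.exists_mem_presLengthValues_coprod_le hA hB
  exact le_antisymm ((Nat.sInf_le ht).trans hle) (PresLength.le_presLength_coprod A B ⟨t, ht⟩)
end

section
/- Let G be a finitely presentable group and let H be a subgroup of G of finite index d = [G:H]. Then H is finitely presentable and T(H) ≤ d · T(G). -/
section WreathCocycle

variable {G X S P Q : Type*} [Group G] [MulAction G X] [Group P] [Group Q]

/-- The homomorphism from a free group to the unrestricted wreath product `(X → P) ⋊ G` which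
sends a generator `s` to `(x ↦ e (x, s), π s)`. -/
def wreathLift (π : FreeGroup S →* G) (e : X × S → P) :
    FreeGroup S →* (X → P) ⋊[mulAutArrow] G :=
  FreeGroup.lift fun s => ⟨fun x => e (x, s), π (FreeGroup.of s)⟩

/-- The product of the labels `e` along the lift of a word to the Schreier graph on `X` that
ends at the vertex `x`; the edge `(x, s)` runs from `(π s)⁻¹ • x` to `x`. -/
def wordLift (π : FreeGroup S →* G) (e : X × S → P) (w : FreeGroup S) (x : X) : P :=
  (wreathLift π e w).left x

variable (π : FreeGroup S →* G) (e : X × S → P)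

lemma wreathLift_right (w : FreeGroup S) : (wreathLift π e w).right = π w := by
  have h : SemidirectProduct.rightHom.comp (wreathLift π e) = π := by
    ext s
    simp [wreathLift]
  exact DFunLike.congr_fun h w

lemma wordLift_of (s : S) (x : X) : wordLift π e (FreeGroup.of s) x = e (x, s) := by
  simp [wordLift, wreathLift]

lemma wordLift_one (x : X) : wordLift π e 1 x = 1 := by
  simp [wordLift]

lemma wordLift_mul (v w : FreeGroup S) (x : X) :
    wordLift π e (v * w) x = wordLift π e v x * wordLift π e w ((π v)⁻¹ • x) := by
  simp only [wordLift, map_mul, SemidirectProduct.mul_left, wreathLift_right]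
  rfl

lemma wordLift_inv (w : FreeGroup S) (x : X) :
    wordLift π e w⁻¹ x = (wordLift π e w (π w • x))⁻¹ := by
  have h := wordLift_mul π e w⁻¹ w x
  rw [inv_mul_cancel, wordLift_one, map_inv, inv_inv] at h
  exact eq_inv_of_mul_eq_one_left h.symm

lemma map_wordLift (f : P →* Q) (w : FreeGroup S) (x : X) :
    f (wordLift π e w x) = wordLift π (f ∘ e) w x := by
  induction w using FreeGroup.induction_on generalizing x with
  | C1 => simp [wordLift_one]
  | of s => simp [wordLift_of]
  | inv_of s h => simp [wordLift_inv, wordLift_of]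
  | mul v w hv hw => simp [wordLift_mul, hv, hw]

/-- Labelling edges by a coboundary twist of `π`, the label of a lifted word telescopes. -/
lemma wordLift_coboundary (t : X → G) (w : FreeGroup S) (x : X) :
    wordLift π (fun p : X × S => (t p.1)⁻¹ * π (FreeGroup.of p.2) *
      t ((π (FreeGroup.of p.2))⁻¹ • p.1)) w x = (t x)⁻¹ * π w * t ((π w)⁻¹ • x) := by
  induction w using FreeGroup.induction_on generalizing x with
  | C1 => simp [wordLift_one]
  | of s => simp [wordLift_of]
  | inv_of s h => simp [wordLift_inv, wordLift_of, mul_assoc]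
  | mul v w hv hw => rw [wordLift_mul, hv, hw]; simp [mul_assoc, mul_smul]

lemma wordLift_eq_of_map_eq {rels : Set (FreeGroup S)} (hker : π.ker = Subgroup.normalClosure rels)
    (he : ∀ r ∈ rels, ∀ x, wordLift π e r x = 1) {v w : FreeGroup S} (hvw : π v = π w) :
    wordLift π e v = wordLift π e w := by
  have hle : π.ker ≤ (wreathLift π e).ker := by
    rw [hker]
    refine Subgroup.normalClosure_le_normal fun r hr => ?_
    have hr1 : π r = 1 := by
      rw [← MonoidHom.mem_ker, hker]
      exact Subgroup.subset_normalClosure hr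
    refine MonoidHom.mem_ker.2 (SemidirectProduct.ext (funext (he r hr)) ?_)
    rw [wreathLift_right, hr1]
    rfl
  have h : v⁻¹ * w ∈ (wreathLift π e).ker := hle (by simp [MonoidHom.mem_ker, hvw])
  rw [MonoidHom.mem_ker, map_mul, map_inv, inv_mul_eq_one] at h
  exact funext fun x => by rw [wordLift, wordLift, h]

lemma norm_wordLift_le [DecidableEq S] [DecidableEq (X × S)] (w : FreeGroup S) (x : X) :
    (wordLift π (FreeGroup.of : X × S → _) w x).norm ≤ w.norm := by
  have key : ∀ (L : List (S × Bool)) (x : X),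
      (wordLift π (FreeGroup.of : X × S → _) (FreeGroup.mk L) x).norm ≤ L.length := by
    intro L
    induction L with
    | nil => intro x; rw [← FreeGroup.one_eq_mk, wordLift_one]; simp
    | cons a L ih =>
      intro x
      have hL : FreeGroup.mk (a :: L) = FreeGroup.mk [a] * FreeGroup.mk L := by
        rw [FreeGroup.mul_mk]; rfl
      have ha : ∀ x, (wordLift π (FreeGroup.of : X × S → _) (FreeGroup.mk [a]) x).norm ≤ 1 := by
        intro x
        obtain ⟨s, _ | _⟩ := a
        · have : FreeGroup.mk [(s, false)] = (FreeGroup.of s)⁻¹ := by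
            simp [FreeGroup.of, FreeGroup.inv_mk, FreeGroup.invRev]
          simp [this, wordLift_inv, wordLift_of]
        · have : FreeGroup.mk [(s, true)] = FreeGroup.of s := rfl
          simp [this, wordLift_of]
      rw [hL, wordLift_mul, List.length_cons]
      refine (FreeGroup.norm_mul_le _ _).trans ?_
      have := ha x
      have := ih ((π (FreeGroup.mk [a]))⁻¹ • x)
      omega
  conv_lhs => rw [← FreeGroup.mk_toWord (x := w)]
  exact key _ _

end WreathCocycle

lemma exists_recursion_on_measure {X F : Type*} (ℓ : X → ℕ) (x₀ : X) (a : F) (step : X → F → F)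
    (parent : X → X) (hparent : ∀ x, x ≠ x₀ → ℓ (parent x) < ℓ x) :
    ∃ τ : X → F, τ x₀ = a ∧ ∀ x, x ≠ x₀ → τ x = step x (τ (parent x)) := by
  classical
  let rec_step : (x : X) → ((y : X) → ℓ y < ℓ x → F) → F := fun x f =>
    if h : x = x₀ then a else step x (f (parent x) (hparent x h))
  have wf : WellFounded fun y x : X => ℓ y < ℓ x := (measure ℓ).wf
  refine ⟨wf.fix rec_step, ?_, fun x hx => ?_⟩
  · rw [wf.fix_eq]; simp [rec_step]
  · conv_lhs => rw [wf.fix_eq]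
    simp [rec_step, hx]

section Schreier

variable {G X S : Type*} [Group G] [MulAction G X] [MulAction.IsPretransitive G X]

/-- Existence of a Schreier transversal, as a family of words built along a spanning tree. -/
lemma exists_schreier_transversal (π : FreeGroup S →* G) (hπ : Function.Surjective π) (x₀ : X) :
    ∃ (τ : X → FreeGroup S) (ℓ : X → ℕ), τ x₀ = 1 ∧ (∀ x, π (τ x) • x₀ = x) ∧
      ∀ x, x ≠ x₀ → ∃ (y : X) (s : S), ℓ y < ℓ x ∧
        (τ x = FreeGroup.of s * τ y ∨ τ x = (FreeGroup.of s)⁻¹ * τ y) := by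
  classical
  have hex : ∀ x : X, ∃ n, ∃ L : List (S × Bool), L.length = n ∧ π (FreeGroup.mk L) • x₀ = x := by
    intro x
    obtain ⟨g, rfl⟩ := MulAction.exists_smul_eq G x₀ x
    obtain ⟨w, rfl⟩ := hπ g
    exact ⟨_, w.toWord, rfl, by rw [FreeGroup.mk_toWord]⟩
  let ℓ : X → ℕ := fun x => Nat.find (hex x)
  have hpar : ∀ x : X, ∃ (y : X) (a : FreeGroup S), x ≠ x₀ → ℓ y < ℓ x ∧ π a • y = x ∧
      ∃ s, a = FreeGroup.of s ∨ a = (FreeGroup.of s)⁻¹ := by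
    intro x
    obtain ⟨L, hL, hx⟩ := Nat.find_spec (hex x)
    match L, hL, hx with
    | [], _, hx => exact ⟨x, 1, fun h => absurd (by simpa [← FreeGroup.one_eq_mk] using hx.symm) h⟩
    | (s, b) :: L, hL, hx =>
      refine ⟨π (FreeGroup.mk L) • x₀, FreeGroup.mk [(s, b)], fun _ => ⟨?_, ?_, s, ?_⟩⟩
      · refine lt_of_le_of_lt (Nat.find_min' (hex _) ⟨L, rfl, rfl⟩) ?_
        change _ < Nat.find (hex x)
        rw [← hL, List.length_cons]
        exact Nat.lt_succ_self _
      · rw [← mul_smul, ← map_mul, FreeGroup.mul_mk]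
        exact hx
      · cases b
        · right
          simp [FreeGroup.of, FreeGroup.inv_mk, FreeGroup.invRev]
        · left
          rfl
  choose parent a ha using hpar
  obtain ⟨τ, hτ₀, hτ⟩ := exists_recursion_on_measure ℓ x₀ (1 : FreeGroup S)
    (fun x w => a x * w) parent fun x hx => (ha x hx).1
  refine ⟨τ, ℓ, hτ₀, fun x => ?_, fun x hx => ?_⟩
  · induction h : ℓ x using Nat.strong_induction_on generalizing x with
    | _ n ih =>
      by_cases hx : x = x₀
      · rw [hx, hτ₀, map_one, one_smul]
      · obtain ⟨hlt, hax, -⟩ := ha x hx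
        rw [hτ x hx, map_mul, mul_smul, ih _ (h ▸ hlt) _ rfl, hax]
  · obtain ⟨hlt, -, s, hs⟩ := ha x hx
    refine ⟨parent x, s, hlt, ?_⟩
    rw [hτ x hx]
    rcases hs with hs | hs <;> simp [hs]

/-- Reidemeister–Schreier: a point stabilizer of a transitive action of a presented group is
presented by the lifted relators together with a set of generators. -/
theorem exists_stabilizer_presentation (π : FreeGroup S →* G) (hπ : Function.Surjective π)
    {rels : Set (FreeGroup S)} (hker : π.ker = Subgroup.normalClosure rels) (x₀ : X) :
    ∃ T : Set (X × S), Nonempty (MulAction.stabilizer G x₀ ≃* PresentedGroup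
      (FreeGroup.of '' T ∪ {q | ∃ r ∈ rels, ∃ x : X, q = wordLift π FreeGroup.of r x})) := by
  obtain ⟨τ, ℓ, hτ₀, hτx, hτ⟩ := exists_schreier_transversal π hπ x₀
  let T : Set (X × S) :=
    {p | π (τ p.1) = π (FreeGroup.of p.2 * τ ((π (FreeGroup.of p.2))⁻¹ • p.1))}
  refine ⟨T, ?_⟩
  set R : Set (FreeGroup (X × S)) :=
    FreeGroup.of '' T ∪ {q | ∃ r ∈ rels, ∃ x : X, q = wordLift π FreeGroup.of r x}
  let e : X × S → PresentedGroup R := PresentedGroup.of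
  have he : ∀ r ∈ rels, ∀ x, wordLift π e r x = 1 := fun r hr x => by
    have h := map_wordLift π (FreeGroup.of : X × S → _) (PresentedGroup.mk R) r x
    exact h.symm.trans (PresentedGroup.one_of_mem (Or.inr ⟨r, hr, x, rfl⟩))
  have heT : ∀ p ∈ T, e p = 1 := fun p hp =>
    PresentedGroup.one_of_mem (rels := R) (Or.inl ⟨p, hp, rfl⟩)
  have hwell : ∀ {v w}, π v = π w → wordLift π e v = wordLift π e w :=
    fun h => wordLift_eq_of_map_eq π e hker he h
  have htree : ∀ x, wordLift π e (τ x) x = 1 := by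
    intro x
    induction h : ℓ x using Nat.strong_induction_on generalizing x with
    | _ n ih =>
      by_cases hx : x = x₀
      · rw [hx, hτ₀, wordLift_one]
      · obtain ⟨y, s, hlt, hs⟩ := hτ x hx
        have hy := ih _ (h ▸ hlt) y rfl
        rcases hs with hs | hs
        · have hxy : x = π (FreeGroup.of s) • y := by
            rw [← hτx x, hs, map_mul, mul_smul, hτx]
          have hT : (x, s) ∈ T := by
            simp only [T, Set.mem_ofPred_eq]
            rw [hs, hxy, inv_smul_smul]
          rw [hs, wordLift_mul, wordLift_of, heT _ hT, hxy, inv_smul_smul, hy, one_mul]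
        · have hxy : y = π (FreeGroup.of s) • x := by
            rw [← hτx x, hs, map_mul, mul_smul, hτx, map_inv, smul_inv_smul]
          have hT : (y, s) ∈ T := by
            simp only [T, Set.mem_ofPred_eq]
            rw [hxy, inv_smul_smul, ← hxy, hs, mul_inv_cancel_left]
          rw [hs, wordLift_mul, wordLift_inv, wordLift_of, map_inv, inv_inv, ← hxy, heT _ hT, hy,
            inv_one, one_mul]
  let b : X × S → G := fun p => (π (τ p.1))⁻¹ * π (FreeGroup.of p.2) *
    π (τ ((π (FreeGroup.of p.2))⁻¹ • p.1))
  have hb : ∀ w x, wordLift π b w x = (π (τ x))⁻¹ * π w * π (τ ((π w)⁻¹ • x)) :=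
    wordLift_coboundary π fun x => π (τ x)
  have hbstab : ∀ p, b p ∈ MulAction.stabilizer G x₀ := by
    intro p
    rw [MulAction.mem_stabilizer_iff, mul_smul, mul_smul, hτx, smul_inv_smul, inv_smul_eq_iff, hτx]
  have hπrel : ∀ r ∈ rels, π r = 1 := fun r hr => by
    rw [← MonoidHom.mem_ker, hker]
    exact Subgroup.subset_normalClosure hr
  have hbrel : ∀ q ∈ R,
      FreeGroup.lift (fun p => (⟨b p, hbstab p⟩ : MulAction.stabilizer G x₀)) q = 1 := by
    rintro q (⟨p, hp, rfl⟩ | ⟨r, hr, x, rfl⟩)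
    · rw [FreeGroup.lift_apply_of]
      refine Subtype.ext ?_
      change b p = 1
      have hp' : π (τ p.1) = _ := hp
      simp only [b, hp', map_mul]
      group
    · rw [map_wordLift]
      refine Subtype.ext ?_
      rw [← Subgroup.coe_subtype, map_wordLift]
      have : (MulAction.stabilizer G x₀).subtype ∘
          (FreeGroup.lift (fun p => (⟨b p, hbstab p⟩ : MulAction.stabilizer G x₀)) ∘ FreeGroup.of)
          = b := by
        funext p; simp
      rw [this, hb, hπrel r hr]
      simp
  let β : PresentedGroup R →* MulAction.stabilizer G x₀ := PresentedGroup.toGroup hbrel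
  have hβe : ∀ p, β (e p) = ⟨b p, hbstab p⟩ := fun p => PresentedGroup.toGroup.of hbrel
  let σ : G → FreeGroup S := Function.surjInv hπ
  have hσ : ∀ g, π (σ g) = g := Function.surjInv_eq hπ
  let α : MulAction.stabilizer G x₀ →* PresentedGroup R :=
    MonoidHom.mk' (fun h => wordLift π e (σ h) x₀) fun g h => by
      have hgh : π (σ (g * h : G)) = π (σ g * σ h) := by simp [hσ]
      have hg : (π (σ g))⁻¹ • x₀ = x₀ := by
        rw [hσ, inv_smul_eq_iff]
        exact g.2.symm
      change wordLift π e (σ (g * h : G)) x₀ = _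
      rw [hwell hgh, wordLift_mul, hg]
  refine ⟨MulEquiv.ofBijective α ⟨?_, ?_⟩⟩
  · refine Function.LeftInverse.injective (g := β) fun h => Subtype.ext ?_
    change (MulAction.stabilizer G x₀).subtype (β (wordLift π e (σ h) x₀)) = h
    rw [map_wordLift, map_wordLift]
    have : (MulAction.stabilizer G x₀).subtype ∘ (β ∘ e) = b := by
      funext p; simp [hβe]
    have hh : (h : G)⁻¹ • x₀ = x₀ := by
      rw [inv_smul_eq_iff]
      exact h.2.symm
    rw [this, hb, hσ, hh, hτ₀]
    simp
  · refine Function.RightInverse.surjective (g := β) fun p => ?_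
    have hid : α.comp β = MonoidHom.id _ := by
      ext ⟨x, s⟩
      change α (β (e (x, s))) = e (x, s)
      rw [hβe]
      have hw : π (σ (b (x, s))) =
          π ((τ x)⁻¹ * (FreeGroup.of s * τ ((π (FreeGroup.of s))⁻¹ • x))) := by
        simp [hσ, b, mul_assoc]
      change wordLift π e (σ (b (x, s))) x₀ = _
      rw [hwell hw, wordLift_mul, wordLift_inv, map_inv, inv_inv, hτx, htree, inv_one, one_mul,
        wordLift_mul, wordLift_of, htree, mul_one]
    exact DFunLike.congr_fun hid p

end Schreier

lemma FreeGroup.norm_map_le {α β : Type*} [DecidableEq α] [DecidableEq β] (f : α → β)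
    (w : FreeGroup α) : (FreeGroup.map f w).norm ≤ w.norm := by
  conv_lhs => rw [← FreeGroup.mk_toWord (x := w), FreeGroup.map.mk]
  exact FreeGroup.norm_mk_le.trans (by simp [FreeGroup.norm])

lemma exists_mem_presLengthValues_le {H ι : Type*} [Group H] [Finite ι] [DecidableEq ι]
    (rels : List (FreeGroup ι)) (φ : H ≃* PresentedGroup {r | r ∈ rels}) :
    ∃ t ∈ presLengthValues H, t ≤ (rels.map fun r => r.norm - 2).sum := by
  obtain ⟨n, ⟨f⟩⟩ := Finite.exists_equiv_fin ι
  have himage : FreeGroup.freeGroupCongr f '' {r | r ∈ rels} =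
      {r | r ∈ rels.map (FreeGroup.map f)} := by
    ext r
    simp [FreeGroup.freeGroupCongr_apply]
  refine ⟨_, ⟨n, rels.map (FreeGroup.map f), ⟨?_⟩, rfl⟩, ?_⟩
  · rw [← himage]
    exact φ.trans (PresentedGroup.equivPresentedGroup {r | r ∈ rels} f)
  · rw [List.map_map]
    exact List.sum_le_sum fun r _ => Nat.sub_le_sub_right (FreeGroup.norm_map_le f r) 2

lemma exists_mem_presLengthValues_subgroup_le {G : Type*} [Group G] (H : Subgroup G)
    (hH : H.index ≠ 0) {t : ℕ} (ht : t ∈ presLengthValues G) :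
    ∃ u ∈ presLengthValues H, u ≤ H.index * t := by
  classical
  obtain ⟨n, rels, ⟨φ⟩, rfl⟩ := ht
  have : H.FiniteIndex := ⟨hH⟩
  have : Fintype (G ⧸ H) := Fintype.ofFinite _
  let π : FreeGroup (Fin n) →* G := φ.symm.toMonoidHom.comp (PresentedGroup.mk _)
  have hπ : Function.Surjective π :=
    φ.symm.surjective.comp (PresentedGroup.mk_surjective _)
  have hker : π.ker = Subgroup.normalClosure {r | r ∈ rels} := by
    ext w
    simp [π, MonoidHom.mem_ker, PresentedGroup.mk_eq_one_iff]
  obtain ⟨T, ⟨ψ⟩⟩ := exists_stabilizer_presentation π hπ hker ((1 : G) : G ⧸ H)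
  rw [MulAction.stabilizer_quotient] at ψ
  let lifted : List (FreeGroup ((G ⧸ H) × Fin n)) :=
    rels.flatMap fun r => Finset.univ.toList.map fun x => wordLift π FreeGroup.of r x
  let edges : List (FreeGroup ((G ⧸ H) × Fin n)) := T.toFinset.toList.map FreeGroup.of
  have hrels : FreeGroup.of '' T ∪ {q | ∃ r ∈ {r | r ∈ rels}, ∃ x : G ⧸ H,
      q = wordLift π FreeGroup.of r x} = {q | q ∈ edges ++ lifted} := by
    ext q
    simp [edges, lifted, eq_comm]
  rw [hrels] at ψ
  obtain ⟨u, hu, hle⟩ := exists_mem_presLengthValues_le _ ψ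
  refine ⟨u, hu, hle.trans ?_⟩
  have hedges : (edges.map fun r => r.norm - 2).sum = 0 := by
    simp [edges, Function.comp_def]
  have hlifted : ∀ L : List (FreeGroup (Fin n)),
      ((L.flatMap fun r => Finset.univ.toList.map fun x : G ⧸ H =>
        wordLift π FreeGroup.of r x).map fun r => r.norm - 2).sum ≤
      H.index * (L.map fun r => r.norm - 2).sum := by
    intro L
    induction L with
    | nil => simp
    | cons r L ih =>
      rw [List.flatMap_cons, List.map_append, List.sum_append, List.map_cons, List.sum_cons,
        mul_add]
      refine add_le_add ?_ ih
      rw [List.map_map, Finset.sum_map_toList, Subgroup.index, Nat.card_eq_fintype_card]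
      exact Finset.sum_le_card_nsmul _ _ _ fun x _ =>
        Nat.sub_le_sub_right (norm_wordLift_le π r x) 2
  rw [List.map_append, List.sum_append, hedges, zero_add]
  exact hlifted rels

/-- A finite-index subgroup `H` of a finitely presentable group `G` is finitely
presentable, and `T(H) ≤ [G:H] · T(G)`. -/
theorem presLength_finiteIndex_subgroup (G : Type*) [Group G]
    (hG : FinitelyPresentable G) (H : Subgroup G) (hH : H.index ≠ 0) :
    FinitelyPresentable H ∧ presLength H ≤ H.index * presLength G := by
  obtain ⟨t, ht, hle⟩ := exists_mem_presLengthValues_subgroup_le H hH (Nat.sInf_mem hG)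
  exact ⟨⟨t, ht⟩, (Nat.sInf_le ht).trans hle⟩
end

section
/- Given a norm ‖·‖ on ℝ^n, there exists a constant ε_n > 0 such that every lattice Λ in ℝ^n admits a ℤ-basis (v_1, …, v_n) with d(Λ) ≥ ε_n · ‖v_1‖ ⋯ ‖v_n‖, where d(Λ) is the covolume of Λ. -/
open Submodule in
/-- Adding integer multiples of the first vector to the others does not change the `ℤ`-span. -/
lemma span_int_range_cons_add_zsmul {M : Type*} [AddCommGroup M] {k : ℕ} (a : M) (y : Fin k → M)
    (c : Fin k → ℤ) :
    span ℤ (Set.range (Fin.cons a fun i => y i + c i • a : Fin (k + 1) → M)) =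
      span ℤ (Set.range (Fin.cons a y : Fin (k + 1) → M)) := by
  have key : ∀ (y : Fin k → M) (c : Fin k → ℤ),
      span ℤ (Set.range (Fin.cons a fun i => y i + c i • a : Fin (k + 1) → M)) ≤
        span ℤ (Set.range (Fin.cons a y : Fin (k + 1) → M)) := by
    intro y c
    have ha : a ∈ span ℤ (Set.range (Fin.cons a y : Fin (k + 1) → M)) :=
      subset_span ⟨0, rfl⟩
    rw [span_le]
    rintro _ ⟨i, rfl⟩
    refine Fin.cases ha (fun i => ?_) i
    exact add_mem (subset_span ⟨i.succ, rfl⟩) (zsmul_mem ha _)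
  refine le_antisymm (key y c) ?_
  simpa using key (fun i => y i + c i • a) (-c)

/-- A spanning family of the `ℤ`-span of a linearly independent family of the same length is
itself linearly independent. -/
lemma LinearIndependent.of_span_int_eq {E ι : Type*} [AddCommGroup E] [Module ℝ E] [Fintype ι]
    {v w : ι → E} (hw : LinearIndependent ℝ w)
    (h : Submodule.span ℤ (Set.range v) = Submodule.span ℤ (Set.range w)) :
    LinearIndependent ℝ v := by
  have h' : Submodule.span ℝ (Set.range v) = Submodule.span ℝ (Set.range w) := by
    rw [← Submodule.span_span_of_tower ℤ ℝ, h, Submodule.span_span_of_tower]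
  rw [linearIndependent_iff_card_eq_finrank_span] at hw ⊢
  rw [hw, Set.finrank, Set.finrank, h']

section InnerProductSpace

variable {E : Type*} [NormedAddCommGroup E] [InnerProductSpace ℝ E]

/-- The `ℤ`-span of a linearly independent family has finitely many points in a bounded set. -/
lemma LinearIndependent.finite_inter_span_int [FiniteDimensional ℝ E] {ι : Type*} {w : ι → E}
    (hw : LinearIndependent ℝ w) {s : Set E} (hs : Bornology.IsBounded s) :
    (s ∩ Submodule.span ℤ (Set.range w)).Finite := by
  let b := Module.Basis.extend hw.linearIndepOn_id
  have : Finite (hw.linearIndepOn_id.extend (Set.subset_univ (Set.range w))) :=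
    Module.Finite.finite_basis b
  have : ProperSpace E := FiniteDimensional.proper ℝ E
  refine (ZSpan.setFinite_inter b hs).subset (Set.inter_subset_inter_right _ ?_)
  refine Submodule.span_mono ?_
  rw [Module.Basis.range_extend]
  exact Module.Basis.subset_extend _

/-- Among all the `ℤ`-bases of a lattice there is one whose first vector is no longer than any
vector of any other `ℤ`-basis. -/
lemma exists_basis_minimal_norm [FiniteDimensional ℝ E] {k : ℕ} {w : Fin (k + 1) → E}
    (hw : LinearIndependent ℝ w) :
    ∃ v : Fin (k + 1) → E, Submodule.span ℤ (Set.range v) = Submodule.span ℤ (Set.range w) ∧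
      ∀ u : Fin (k + 1) → E, Submodule.span ℤ (Set.range u) = Submodule.span ℤ (Set.range w) →
        ∀ i, ‖v 0‖ ≤ ‖u i‖ := by
  let S : Set E := {x | ∃ u : Fin (k + 1) → E,
    Submodule.span ℤ (Set.range u) = Submodule.span ℤ (Set.range w) ∧ ∃ i, u i = x}
  have hS : S ⊆ Submodule.span ℤ (Set.range w) := by
    rintro _ ⟨u, hu, i, rfl⟩
    rw [← hu]
    exact Submodule.subset_span ⟨i, rfl⟩
  have hfin : (Metric.closedBall 0 ‖w 0‖ ∩ S).Finite :=
    (hw.finite_inter_span_int Metric.isBounded_closedBall).subset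
      (Set.inter_subset_inter_right _ hS)
  obtain ⟨x, ⟨hxw, u, hu, i, rfl⟩, hmin⟩ := Set.exists_min_image _ (fun x : E => ‖x‖) hfin
    ⟨w 0, by simp, w, rfl, 0, rfl⟩
  refine ⟨u ∘ Equiv.swap 0 i, ?_, fun u' hu' j => ?_⟩
  · rw [EquivLike.range_comp, hu]
  · simp only [Function.comp_apply, Equiv.swap_apply_left]
    by_cases hj : ‖u' j‖ ≤ ‖w 0‖
    · exact hmin _ ⟨by simpa using hj, u', hu', j, rfl⟩
    · exact (by simpa using hxw : ‖u i‖ ≤ ‖w 0‖).trans (not_le.mp hj).le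

open Matrix in
/-- The Gram determinant of `a, z₁, …, zₖ` is `‖a‖²` times the Gram determinant of the components
of the `zᵢ` orthogonal to `a`. -/
lemma det_gram_cons {k : ℕ} (a : E) (u z : Fin k → E) (t : Fin k → ℝ)
    (hu : ∀ i, inner ℝ a (u i) = 0) (hz : ∀ i, z i = u i + t i • a) :
    (gram ℝ (Fin.cons a z : Fin (k + 1) → E)).det = ‖a‖ ^ 2 * (gram ℝ u).det := by
  have hu' : ∀ i, inner ℝ (u i) a = 0 := fun i => by rw [real_inner_comm, hu]
  let B : Matrix (Fin (k + 1)) (Fin (k + 1)) ℝ := of fun i j =>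
    inner ℝ ((Fin.cons a u : Fin (k + 1) → E) i) ((Fin.cons a z : Fin (k + 1) → E) j)
  have hB : (gram ℝ (Fin.cons a z : Fin (k + 1) → E)).det = B.det := by
    refine det_eq_of_forall_row_eq_smul_add_const (Fin.cons 0 t) 0 rfl fun i j => ?_
    refine Fin.cases ?_ (fun i => ?_) i
    · simp [B]
    · simp [B, hz i, inner_add_left, inner_smul_left]
  rw [hB, det_succ_column_zero, Fin.sum_univ_succ]
  have hsub : B.submatrix (Fin.succAbove 0) Fin.succ = gram ℝ u := by
    ext i j
    simp [B, hz j, inner_add_right, inner_smul_right, hu']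
  rw [hsub]
  simp [B, hu']

open Submodule Matrix in
/-- Hermite's inequality: a lattice has a `ℤ`-basis with bounded orthogonality defect. -/
theorem exists_basis_prod_norm_sq_le [FiniteDimensional ℝ E] (k : ℕ) :
    ∃ C : ℝ, 0 < C ∧ ∀ w : Fin k → E, LinearIndependent ℝ w →
      ∃ v : Fin k → E, span ℤ (Set.range v) = span ℤ (Set.range w) ∧
        ∏ i, ‖v i‖ ^ 2 ≤ C * (gram ℝ v).det := by
  induction k with
  | zero => exact ⟨1, one_pos, fun w _ => ⟨w, rfl, by simp⟩⟩
  | succ k ih =>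
    obtain ⟨C, hC, ih⟩ := ih
    refine ⟨(4 / 3) ^ k * C, by positivity, fun w₀ hw₀ => ?_⟩
    obtain ⟨w, hspan, hmin⟩ := exists_basis_minimal_norm hw₀
    obtain ⟨hlin, hnot⟩ := linearIndependent_finSucc.mp (hw₀.of_span_int_eq hspan)
    set a := w 0
    have ha : a ≠ 0 := fun h => hnot (h ▸ zero_mem _)
    obtain ⟨π, hπ⟩ : ∃ π : E →ₗ[ℝ] E, ∀ x, π x = x - (inner ℝ a x / ‖a‖ ^ 2) • a :=
      ⟨LinearMap.id - (ℝ ∙ a).starProjection.toLinearMap, fun x => by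
        simp [starProjection_singleton]⟩
    have hπa : ∀ x, inner ℝ a (π x) = 0 := fun x => by
      have : ‖a‖ ≠ 0 := norm_ne_zero_iff.mpr ha
      rw [hπ, inner_sub_right, inner_smul_right, real_inner_self_eq_norm_sq]
      field_simp
      ring
    have hdisj : Disjoint (span ℝ (Set.range (Fin.tail w))) (LinearMap.ker π) := by
      rw [Submodule.disjoint_def]
      intro x hx hx0
      rw [LinearMap.mem_ker, hπ, sub_eq_zero] at hx0
      by_cases hc : inner ℝ a x / ‖a‖ ^ 2 = 0
      · rw [hx0, hc, zero_smul]
      · rw [hx0] at hx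
        exact absurd ((smul_mem_iff _ hc).mp hx) hnot
    obtain ⟨u, hu, hprod⟩ := ih (π ∘ Fin.tail w) (hlin.map hdisj)
    let M : Submodule ℤ E := span ℤ (Set.range (Fin.tail w))
    let πZ : E →ₗ[ℤ] E := π.restrictScalars ℤ
    have hMu : span ℤ (Set.range u) = M.map πZ := by
      rw [hu, Submodule.map_span, Set.range_comp]
      rfl
    have hlift : ∀ i, ∃ y ∈ M, π y = u i := fun i => by
      have : u i ∈ M.map πZ := hMu ▸ subset_span ⟨i, rfl⟩
      exact this
    choose y hyM hy using hlift
    have hM : M ≤ (span ℝ (Set.range (Fin.tail w))).restrictScalars ℤ := span_subset_span _ _ _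
    have hyspan : span ℤ (Set.range y) = M := by
      have hle : span ℤ (Set.range y) ≤ M := by
        rw [span_le]
        rintro _ ⟨i, rfl⟩
        exact hyM i
      refine le_antisymm hle fun m hm => ?_
      have hmem : πZ m ∈ (span ℤ (Set.range y)).map πZ := by
        have : (span ℤ (Set.range y)).map πZ = M.map πZ := by
          rw [← hMu, Submodule.map_span, ← Set.range_comp]
          congr 2
          exact funext hy
        rw [this]
        exact mem_map_of_mem hm
      obtain ⟨x, hx, hxm⟩ := hmem
      have : m = x := sub_eq_zero.mp <| (Submodule.disjoint_def.mp hdisj) _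
        (sub_mem (hM hm) (hM (hle hx))) (by
          rw [LinearMap.mem_ker, map_sub, sub_eq_zero]
          exact hxm.symm)
      exact this ▸ hx
    let μ : Fin k → ℝ := fun i => inner ℝ a (y i) / ‖a‖ ^ 2
    let z : Fin k → E := fun i => y i + (-round (μ i)) • a
    have hz : ∀ i, z i = u i + (μ i - round (μ i)) • a := fun i => by
      simp only [z, ← hy, hπ, μ]
      rw [sub_smul, neg_smul, Int.cast_smul_eq_zsmul]
      abel
    have hua : ∀ i, inner ℝ a (u i) = 0 := fun i => hy i ▸ hπa (y i)
    have hzspan : span ℤ (Set.range (Fin.cons a z : Fin (k + 1) → E)) =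
        span ℤ (Set.range w₀) := by
      rw [span_int_range_cons_add_zsmul, Fin.range_cons, span_insert, hyspan, ← span_insert,
        ← Fin.range_cons, Fin.cons_self_tail, hspan]
    refine ⟨Fin.cons a z, hzspan, ?_⟩
    have hnorm : ∀ i, ‖z i‖ ^ 2 ≤ 4 / 3 * ‖u i‖ ^ 2 := fun i => by
      have h1 : ‖z i‖ ^ 2 = ‖u i‖ ^ 2 + (μ i - round (μ i)) ^ 2 * ‖a‖ ^ 2 := by
        rw [hz, norm_add_sq_real, inner_smul_right, real_inner_comm, hua, norm_smul, mul_pow,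
          Real.norm_eq_abs, sq_abs]
        ring
      have h2 : (μ i - round (μ i)) ^ 2 ≤ 1 / 4 := by
        have := sq_le_sq' (abs_le.mp (abs_sub_round (μ i))).1 (abs_le.mp (abs_sub_round (μ i))).2
        linarith
      have h3 : ‖a‖ ^ 2 ≤ ‖z i‖ ^ 2 := by
        have := hmin _ hzspan i.succ
        gcongr
        simpa using this
      nlinarith [mul_le_mul_of_nonneg_right h2 (sq_nonneg ‖a‖)]
    rw [det_gram_cons a u z _ hua hz, Fin.prod_univ_succ]
    simp only [Fin.cons_zero, Fin.cons_succ]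
    calc ‖a‖ ^ 2 * ∏ i, ‖z i‖ ^ 2 ≤ ‖a‖ ^ 2 * ∏ i, (4 / 3 * ‖u i‖ ^ 2) := by
          gcongr with i
          exact hnorm i
      _ = ‖a‖ ^ 2 * ((4 / 3) ^ k * ∏ i, ‖u i‖ ^ 2) := by
          rw [Finset.prod_mul_distrib, Finset.prod_const, Finset.card_univ, Fintype.card_fin]
      _ ≤ ‖a‖ ^ 2 * ((4 / 3) ^ k * (C * (gram ℝ u).det)) := by gcongr
      _ = _ := by ring

end InnerProductSpace

/-- A norm on `ℝⁿ` is bounded by a multiple of the Euclidean norm. -/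
lemma exists_le_mul_euclidean_norm {n : ℕ} (N : (Fin n → ℝ) → ℝ) (hN : ∀ x, 0 ≤ N x)
    (hNsmul : ∀ (c : ℝ) (x), N (c • x) = |c| * N x)
    (hNadd : ∀ x y, N (x + y) ≤ N x + N y) :
    ∃ K : ℝ, 0 < K ∧ ∀ x : EuclideanSpace ℝ (Fin n), N x.ofLp ≤ K * ‖x‖ := by
  have h0 : N 0 = 0 := by simpa using hNsmul 0 0
  refine ⟨∑ i, N (Pi.single i 1) + 1,
    add_pos_of_nonneg_of_pos (Finset.sum_nonneg fun i _ => hN _) one_pos, fun x => ?_⟩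
  calc N x.ofLp = N (∑ i, x i • Pi.single i 1) := by rw [← pi_eq_sum_univ']
    _ ≤ ∑ i, N (x i • Pi.single i 1) := Finset.le_sum_of_subadditive N h0.le hNadd _ _
    _ ≤ ∑ i, N (Pi.single i 1) * ‖x‖ := by
        refine Finset.sum_le_sum fun i _ => ?_
        rw [hNsmul, mul_comm]
        exact mul_le_mul_of_nonneg_left (PiLp.norm_apply_le x i) (hN _)
    _ ≤ _ := by
        rw [← Finset.sum_mul]
        gcongr
        linarith

/-- The Gram determinant of `n` vectors of `ℝⁿ` is the square of their determinant. -/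
lemma det_gram_euclideanSpace {n : ℕ} (v : Fin n → EuclideanSpace ℝ (Fin n)) :
    (Matrix.gram ℝ v).det = (Matrix.of fun i j => v j i).det ^ 2 := by
  have : Matrix.gram ℝ v =
      (Matrix.of fun i j => v j i).transpose * (Matrix.of fun i j => v j i) := by
    ext i j
    simp [Matrix.mul_apply, PiLp.inner_apply, mul_comm]
  rw [this, Matrix.det_mul, Matrix.det_transpose, sq]


/-- Given a norm `N` on `ℝⁿ`, there is a constant `ε > 0` such that every lattice
`Λ` in `ℝⁿ` (the `ℤ`-span of an `ℝ`-basis) has a `ℤ`-basis `v₁, …, vₙ` with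
`d(Λ) ≥ ε · N(v₁) ⋯ N(vₙ)`, where `d(Λ)` is the covolume of `Λ`. -/
theorem lattice_reduced_basis (n : ℕ) (N : (Fin n → ℝ) → ℝ)
    (hN0 : ∀ x, N x = 0 ↔ x = 0)
    (hNsmul : ∀ (c : ℝ) (x), N (c • x) = |c| * N x)
    (hNadd : ∀ x y, N (x + y) ≤ N x + N y) :
    ∃ ε : ℝ, 0 < ε ∧
      ∀ Λ : AddSubgroup (Fin n → ℝ),
        (∃ w : Fin n → (Fin n → ℝ), LinearIndependent ℝ w ∧
            Λ = AddSubgroup.closure (Set.range w)) →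
        ∃ v : Fin n → (Fin n → ℝ), LinearIndependent ℝ v ∧
            Λ = AddSubgroup.closure (Set.range v) ∧
            |(Matrix.of fun i j => v j i).det| ≥ ε * ∏ i, N (v i) := by
  have hN : ∀ x, 0 ≤ N x := fun x => by
    have h := hNadd x ((-1 : ℝ) • x)
    rw [hNsmul, neg_one_smul, add_neg_cancel, (hN0 0).mpr rfl] at h
    norm_num at h
    linarith
  obtain ⟨K, hK, hNK⟩ := exists_le_mul_euclidean_norm N hN hNsmul hNadd
  obtain ⟨C, hC, hbasis⟩ := exists_basis_prod_norm_sq_le (E := EuclideanSpace ℝ (Fin n)) n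
  refine ⟨(√C * K ^ n)⁻¹, by positivity, ?_⟩
  rintro _ ⟨w, hw, rfl⟩
  let e : (Fin n → ℝ) ≃ₗ[ℝ] EuclideanSpace ℝ (Fin n) := (WithLp.linearEquiv 2 ℝ _).symm
  obtain ⟨v, hv, hprod⟩ := hbasis (e ∘ w) (hw.map' e.toLinearMap e.ker)
  have hspan : Submodule.span ℤ (Set.range fun i => (v i).ofLp) =
      Submodule.span ℤ (Set.range w) := by
    have h := congrArg (Submodule.map (e.symm.toLinearMap.restrictScalars ℤ)) hv
    rw [Submodule.map_span, Submodule.map_span, ← Set.range_comp, ← Set.range_comp] at h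
    exact h
  refine ⟨fun i => (v i).ofLp, hw.of_span_int_eq hspan, ?_, ?_⟩
  · rw [← Submodule.span_int_eq_addSubgroupClosure, ← Submodule.span_int_eq_addSubgroupClosure,
      hspan]
  · have hle : ∏ i, ‖v i‖ ≤ √C * |(Matrix.of fun i j => v j i).det| := by
      rw [det_gram_euclideanSpace, Finset.prod_pow] at hprod
      refine le_of_sq_le_sq ?_ (by positivity)
      rwa [mul_pow, Real.sq_sqrt hC.le, sq_abs]
    rw [ge_iff_le, inv_mul_le_iff₀ (by positivity)]
    calc ∏ i, N (v i).ofLp ≤ ∏ i, (K * ‖v i‖) :=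
          Finset.prod_le_prod (fun i _ => hN _) fun i _ => hNK (v i)
      _ = K ^ n * ∏ i, ‖v i‖ := by simp [Finset.prod_mul_distrib]
      _ ≤ K ^ n * (√C * |(Matrix.of fun i j => v j i).det|) := by gcongr
      _ = _ := by ring
end
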